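/- Fix λ ∈ (0,1/2), a cutoff ζ, γ ∈ [0,1), a kernel K satisfying the standing assumptions, ρ ∈ (γ,1) and β = 1/(ρ−γ). For every h₀ ∈ 𝒳_ρ there exists T > 0 (depending on λ and ‖h₀‖_{𝒳_ρ}) and a unique mild solution H ∈ C([0,T];𝒳_ρ) of the regularized problem with initial datum h₀; moreover this solution satisfies sup_{0≤t≤T} ‖H(·,t)‖_{𝒳_ρ} ≤ 2‖h₀‖_{𝒳_ρ} and H(·,t) ≥ 0. -/

import Mathlib

open MeasureTheory Real Set Filter Topology

noncomputable section

namespace Smol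

/-- Standing assumptions on the coagulation kernel `K`: continuity on `(0,∞)²`, symmetry,
nonnegativity, homogeneity of degree `γ` and the growth bound `K(x,y) ≤ C(x^γ + y^γ)`. -/
structure KernelHyp (K : ℝ → ℝ → ℝ) (γ C : ℝ) : Prop where
  cont : ContinuousOn (fun p : ℝ × ℝ => K p.1 p.2) (Ioi (0:ℝ) ×ˢ Ioi (0:ℝ))
  symm : ∀ x y : ℝ, 0 < x → 0 < y → K x y = K y x
  nonneg : ∀ x y : ℝ, 0 < x → 0 < y → 0 ≤ K x y
  homog : ∀ a x y : ℝ, 0 < a → 0 < x → 0 < y → K (a * x) (a * y) = a ^ γ * K x y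
  growth : ∀ x y : ℝ, 0 < x → 0 < y → K x y ≤ C * (x ^ γ + y ^ γ)

/-- A smooth monotone cutoff `ζ`, vanishing on `[0,1/2]` and equal to `1` on `[1,∞)`. -/
structure CutoffHyp (ζ : ℝ → ℝ) : Prop where
  smooth : ContDiffOn ℝ (⊤ : ℕ∞) ζ (Ici (0:ℝ))
  mono : MonotoneOn ζ (Ici (0:ℝ))
  zero : ∀ s : ℝ, s ≤ 1/2 → ζ s = 0
  one : ∀ s : ℝ, 1 ≤ s → ζ s = 1

/-- The regularized kernel `K_λ`. -/
def Kreg (K : ℝ → ℝ → ℝ) (ζ : ℝ → ℝ) (lam : ℝ) (y z : ℝ) : ℝ :=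
  K y z * ζ (y / lam) * ζ (z / lam) * ζ (y / (lam * (y + z))) * ζ (z / (lam * (y + z)))

/-- Membership in the space `𝒳_ρ` of nonnegative Radon measures on `[0,∞)` with
`sup_{R>0} (∫_{[0,R]} dh)/R^{1-ρ} < ∞`. -/
def MemX (ρ : ℝ) (μ : Measure ℝ) : Prop :=
  μ (Iio 0) = 0 ∧ ∃ M : ℝ, ∀ R > (0:ℝ), μ (Icc 0 R) ≤ ENNReal.ofReal (M * R ^ (1 - ρ))

/-- The norm `‖h‖_{𝒳_ρ} = sup_{R>0} (∫_{[0,R]} dh)/R^{1-ρ}`, expressed as the least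
admissible constant. -/
def Xnorm (ρ : ℝ) (μ : Measure ℝ) : ℝ :=
  sInf {M : ℝ | 0 ≤ M ∧ ∀ R > (0:ℝ), μ (Icc 0 R) ≤ ENNReal.ofReal (M * R ^ (1 - ρ))}

/-- The operator `𝒜[H](X,t) = ∫_0^∞ K_λ(Xe^{-βt},Ze^{-βt})/Z dH(Z,t) - βρ`. -/
def Acal (Kl : ℝ → ℝ → ℝ) (β ρ : ℝ) (H : ℝ → Measure ℝ) (X t : ℝ) : ℝ :=
  (∫ Z, Kl (X * exp (-(β * t))) (Z * exp (-(β * t))) / Z ∂(H t)) - β * ρ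

/-- The measure `𝒬[H](·,t)`, i.e. the weighted convolution
`𝒬[H](X,t) = ∫_0^X (K_λ(Ye^{-βt},(X-Y)e^{-βt})/(X-Y)) H(X-Y,t) dH(Y,t)`. -/
def Qcal (Kl : ℝ → ℝ → ℝ) (β : ℝ) (H : ℝ → Measure ℝ) (t : ℝ) : Measure ℝ :=
  Measure.map (fun p : ℝ × ℝ => p.1 + p.2)
    (((H t).prod (H t)).withDensity fun p =>
      ENNReal.ofReal (Kl (p.1 * exp (-(β * t))) (p.2 * exp (-(β * t))) / p.2))

/-- Mild solution on `[0,T]` of the regularized problem, in the sense of measures: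
`H(·,t) = h₀ e^{-∫_0^t 𝒜[H] ds} + ∫_0^t e^{-∫_s^t 𝒜[H] dξ} 𝒬[H](·,s) ds`,
together with membership in `C([0,T];𝒳_ρ)` (weak continuity in time). -/
def IsMildSolution (Kl : ℝ → ℝ → ℝ) (β ρ T : ℝ) (h0 : Measure ℝ)
    (H : ℝ → Measure ℝ) : Prop :=
  (∀ t ∈ Icc (0:ℝ) T, MemX ρ (H t)) ∧
  (∀ φ : ℝ → ℝ, Continuous φ → HasCompactSupport φ →
      ContinuousOn (fun t => ∫ X, φ X ∂(H t)) (Icc (0:ℝ) T)) ∧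
  (∀ t ∈ Icc (0:ℝ) T, ∀ φ : ℝ → ℝ, Continuous φ → HasCompactSupport φ →
      ∫ X, φ X ∂(H t)
        = (∫ X, φ X * exp (-(∫ s in (0:ℝ)..t, Acal Kl β ρ H X s)) ∂h0)
          + ∫ s in (0:ℝ)..t,
              ∫ X, φ X * exp (-(∫ ξ in s..t, Acal Kl β ρ H X ξ)) ∂(Qcal Kl β H s))

/-- The change of variables producing `h(·,t)` from `H(·,t)`:
`h(x,t) = H(xe^{βt},t)` as densities, i.e. `h(·,t) = e^{-βt}·(X ↦ Xe^{-βt})_*H(·,t)`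
as measures; `S_λ(t)h₀` is `Smap β t (H t)` for the mild solution `H` with datum `h₀`. -/
def Smap (β t : ℝ) (ν : Measure ℝ) : Measure ℝ :=
  ENNReal.ofReal (exp (-(β * t))) • Measure.map (fun X => X * exp (-(β * t))) ν

/-- Continuous compactly supported test functions on the line. -/
structure IsTest (φ : ℝ → ℝ) : Prop where
  cont : Continuous φ
  supp : HasCompactSupport φ

namespace IsTest

variable {φ ψ : ℝ → ℝ}

theorem of_bound (h : Continuous φ) {R : ℝ} (hR : ∀ x, R < |x| → φ x = 0) : IsTest φ := by
  refine ⟨h, HasCompactSupport.intro (isCompact_Icc (a := -R) (b := R)) fun x hx => hR x ?_⟩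
  by_contra hlt
  exact hx (abs_le.1 (not_lt.1 hlt))

theorem exists_bound (h : IsTest φ) : ∃ R > 0, ∀ x, R < |x| → φ x = 0 := by
  obtain ⟨R, hR, hsub⟩ := h.supp.isCompact.isBounded.exists_pos_norm_le
  refine ⟨R, hR, fun x hx => ?_⟩
  by_contra hne
  exact absurd (hsub x (subset_tsupport _ hne)) (not_le.2 hx)

theorem mul_right (h : IsTest φ) {g : ℝ → ℝ} (hg : Continuous g) :
    IsTest fun x => φ x * g x :=
  ⟨h.cont.mul hg, h.supp.mul_right⟩

theorem const_mul (h : IsTest φ) (c : ℝ) : IsTest fun x => c * φ x :=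
  ⟨continuous_const.mul h.cont, h.supp.mul_left⟩

theorem add (h : IsTest φ) (h' : IsTest ψ) : IsTest fun x => φ x + ψ x :=
  ⟨h.cont.add h'.cont, h.supp.add h'.supp⟩

theorem sub (h : IsTest φ) (h' : IsTest ψ) : IsTest fun x => φ x - ψ x :=
  ⟨h.cont.sub h'.cont, h.supp.sub h'.supp⟩

theorem integrable (h : IsTest φ) (μ : Measure ℝ) [IsFiniteMeasureOnCompacts μ] :
    Integrable φ μ :=
  h.cont.integrable_of_hasCompactSupport h.supp

end IsTest

/-- The tent function of half-width `n + 1`. -/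
def tent (n : ℕ) (x : ℝ) : ℝ := max 0 (1 - |x| / (n + 1))

theorem tent_nonneg (n : ℕ) (x : ℝ) : 0 ≤ tent n x := le_max_left _ _

theorem tent_le_one (n : ℕ) (x : ℝ) : tent n x ≤ 1 :=
  max_le zero_le_one (by have : 0 ≤ |x| / ((n : ℝ) + 1) := by positivity
                         linarith)

theorem continuous_tent (n : ℕ) : Continuous (tent n) := by
  unfold tent; fun_prop

theorem isTest_tent (n : ℕ) : IsTest (tent n) := by
  refine .of_bound (continuous_tent n) (R := n + 1) fun x hx => max_eq_left ?_
  rw [sub_nonpos, one_le_div (by positivity)]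
  exact hx.le

theorem tent_mono (x : ℝ) : Monotone fun n => tent n x := by
  intro m n hmn
  have : (m : ℝ) ≤ n := by exact_mod_cast hmn
  exact max_le_max le_rfl (by gcongr)

theorem tendsto_tent (x : ℝ) : Tendsto (fun n => tent n x) atTop (𝓝 1) := by
  have h : Tendsto (fun n : ℕ => 1 - |x| / ((n : ℝ) + 1)) atTop (𝓝 (1 - 0)) := by
    refine tendsto_const_nhds.sub (Tendsto.div_atTop tendsto_const_nhds ?_)
    exact tendsto_atTop_add_const_right _ _ tendsto_natCast_atTop_atTop
  have := (tendsto_const_nhds (x := (0 : ℝ))).max h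
  simpa [tent] using this

theorem tent_add_le (n : ℕ) {y z : ℝ} (hy : 0 ≤ y) (hz : 0 ≤ z) :
    tent n (y + z) ≤ tent n y * tent n z := by
  refine max_le (mul_nonneg (tent_nonneg _ _) (tent_nonneg _ _)) ?_
  have hn : (0 : ℝ) < n + 1 := by positivity
  by_cases h : 1 - |y + z| / ((n : ℝ) + 1) ≤ 0
  · exact h.trans (mul_nonneg (tent_nonneg _ _) (tent_nonneg _ _))
  have hy' : 0 ≤ y / ((n : ℝ) + 1) := by positivity
  have hz' : 0 ≤ z / ((n : ℝ) + 1) := by positivity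
  have e : 1 - |y + z| / ((n : ℝ) + 1) = 1 - y / ((n : ℝ) + 1) - z / ((n : ℝ) + 1) := by
    rw [abs_of_nonneg (add_nonneg hy hz)]; ring
  rw [e] at h ⊢
  have h1 : 1 - y / ((n : ℝ) + 1) ≤ tent n y := by
    unfold tent; rw [abs_of_nonneg hy]; exact le_max_right _ _
  have h2 : 1 - z / ((n : ℝ) + 1) ≤ tent n z := by
    unfold tent; rw [abs_of_nonneg hz]; exact le_max_right _ _
  calc _ ≤ (1 - y / ((n : ℝ) + 1)) * (1 - z / ((n : ℝ) + 1)) := by nlinarith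
    _ ≤ _ := mul_le_mul h1 h2 (by linarith) (tent_nonneg _ _)

/-- A test function with values in `[0,1]`, equal to one on `[-R, R]` and vanishing outside
`[-R - ε, R + ε]`. -/
theorem exists_plateau (R : ℝ) {ε : ℝ} (hε : 0 < ε) : ∃ χ : ℝ → ℝ, IsTest χ ∧ (∀ x, 0 ≤ χ x) ∧
    (∀ x, χ x ≤ 1) ∧ (∀ x, |x| ≤ R → χ x = 1) ∧ (∀ x, R + ε < |x| → χ x = 0) ∧
    AntitoneOn χ (Ici 0) := by
  have hz : ∀ x : ℝ, R + ε < |x| → max 0 (min 1 ((R + ε - |x|) / ε)) = 0 := fun x hx =>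
    max_eq_left ((min_le_right _ _).trans (div_nonpos_of_nonpos_of_nonneg (by linarith) hε.le))
  refine ⟨fun x => max 0 (min 1 ((R + ε - |x|) / ε)), .of_bound (by fun_prop) (R := R + ε) hz,
    fun x => le_max_left _ _, fun x => max_le zero_le_one (min_le_left _ _), fun x hx => ?_, hz,
    fun x hx y _ hxy => ?_⟩
  · have : min 1 ((R + ε - |x|) / ε) = 1 := min_eq_left (by rw [one_le_div hε]; linarith)
    simp [this]
  · have hx0 : 0 ≤ x := hx
    have h : |x| ≤ |y| := by rwa [abs_of_nonneg hx0, abs_of_nonneg (hx0.trans hxy)]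
    exact max_le_max le_rfl (min_le_min le_rfl (by gcongr))

theorem integrable_and_integral_le_of_tent {μ : Measure ℝ} {w : ℝ → ℝ}
    (hw : Continuous w) (hw0 : ∀ x, 0 ≤ w x) {B : ℝ} [IsFiniteMeasureOnCompacts μ]
    (h : ∀ n, ∫ x, w x * tent n x ∂μ ≤ B) : Integrable w μ ∧ ∫ x, w x ∂μ ≤ B := by
  have hB : 0 ≤ B := (integral_nonneg fun x => mul_nonneg (hw0 x) (tent_nonneg 0 x)).trans (h 0)
  have hlim : Tendsto (fun n => ∫⁻ x, ENNReal.ofReal (w x * tent n x) ∂μ) atTop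
      (𝓝 (∫⁻ x, ENNReal.ofReal (w x) ∂μ)) := by
    refine lintegral_tendsto_of_tendsto_of_monotone (fun n => ?_) (ae_of_all _ fun x => ?_)
      (ae_of_all _ fun x => ?_)
    · exact (hw.mul (continuous_tent n)).measurable.ennreal_ofReal.aemeasurable
    · intro m n hmn
      exact ENNReal.ofReal_le_ofReal (mul_le_mul_of_nonneg_left (tent_mono x hmn) (hw0 x))
    · refine ENNReal.tendsto_ofReal ?_
      simpa using (tendsto_const_nhds (x := w x)).mul (tendsto_tent x)
  have hle : ∫⁻ x, ENNReal.ofReal (w x) ∂μ ≤ ENNReal.ofReal B := by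
    refine le_of_tendsto' hlim fun n => ?_
    have ht : IsTest fun x => w x * tent n x := by
      simpa [mul_comm] using (isTest_tent n).mul_right hw
    rw [← ofReal_integral_eq_lintegral_ofReal (ht.integrable μ)
      (ae_of_all _ fun x => mul_nonneg (hw0 x) (tent_nonneg n x))]
    exact ENNReal.ofReal_le_ofReal (h n)
  refine ⟨⟨hw.aestronglyMeasurable, ?_⟩, ?_⟩
  · rw [hasFiniteIntegral_iff_ofReal (ae_of_all _ hw0)]
    exact hle.trans_lt ENNReal.ofReal_lt_top
  · rw [integral_eq_lintegral_of_nonneg_ae (ae_of_all _ hw0) hw.aestronglyMeasurable]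
    exact ENNReal.toReal_le_of_le_ofReal hB hle

/-- A vaguely continuous curve of locally finite measures carried by `[0,∞)`. -/
structure VagueCurve (H : ℝ → Measure ℝ) : Prop where
  null : ∀ t, H t (Iio 0) = 0
  fin : ∀ t, IsFiniteMeasureOnCompacts (H t)
  cont : ∀ φ, IsTest φ → Continuous fun t => ∫ x, φ x ∂(H t)

theorem ae_nonneg_of_null {μ : Measure ℝ} (h : μ (Iio 0) = 0) : ∀ᵐ x ∂μ, 0 ≤ x := by
  rw [ae_iff]; simpa [not_le, Iio] using h

theorem VagueCurve.const {μ : Measure ℝ} (h : μ (Iio 0) = 0) [IsFiniteMeasureOnCompacts μ] :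
    VagueCurve fun _ => μ :=
  ⟨fun _ => h, fun _ => inferInstance, fun _ _ => continuous_const⟩

/-- Integrals of jointly continuous families of test functions along a vaguely continuous curve
depend continuously on the parameter. -/
theorem VagueCurve.continuous_integral {P : Type*} [TopologicalSpace P] {H : ℝ → Measure ℝ}
    (hH : VagueCurve H) {τ : P → ℝ} (hτ : Continuous τ) {F : P → ℝ → ℝ}
    (hF : Continuous (Function.uncurry F))
    (hs : ∀ p₀, ∃ R, ∀ᶠ p in 𝓝 p₀, ∀ z, R < |z| → F p z = 0) :
    Continuous fun p => ∫ z, F p z ∂(H (τ p)) := by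
  have := hH.fin
  rw [continuous_iff_continuousAt]
  intro p₀
  obtain ⟨R, hR⟩ := hs p₀
  obtain ⟨χ, hχ, hχ0, -, hχR, -, -⟩ := exists_plateau R one_pos
  have hF1 : ∀ p, Continuous (F p) := fun p => hF.comp (Continuous.prodMk_right p)
  have ht₀ : IsTest (F p₀) := .of_bound (hF1 p₀) hR.self_of_nhds
  have hlim : Tendsto (fun p => ∫ z, F p₀ z ∂(H (τ p))) (𝓝 p₀) (𝓝 (∫ z, F p₀ z ∂(H (τ p₀)))) :=
    ((hH.cont _ ht₀).comp hτ).continuousAt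
  have hmass : Tendsto (fun p => ∫ z, χ z ∂(H (τ p))) (𝓝 p₀) (𝓝 (∫ z, χ z ∂(H (τ p₀)))) :=
    ((hH.cont _ hχ).comp hτ).continuousAt
  have hunif : ∀ ε > 0, ∀ᶠ p in 𝓝 p₀, ∀ z ∈ Icc (-R) R, |F p z - F p₀ z| < ε := by
    intro ε hε
    refine (isCompact_Icc (a := -R) (b := R)).eventually_forall_of_forall_eventually fun z _ => ?_
    have hc : Continuous fun q : P × ℝ => |F q.1 q.2 - F p₀ q.2| :=
      (hF.sub ((hF1 p₀).comp continuous_snd)).abs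
    exact hc.continuousAt.eventually_lt continuousAt_const (by simpa using hε)
  have hdiff : Tendsto (fun p => ∫ z, F p z ∂(H (τ p)) - ∫ z, F p₀ z ∂(H (τ p)))
      (𝓝 p₀) (𝓝 0) := by
    rw [Metric.tendsto_nhds]
    intro ε hε
    set M := ∫ z, χ z ∂(H (τ p₀)) with hM
    have hM0 : 0 ≤ M := integral_nonneg hχ0
    have hδ : 0 < ε / (M + 1) := by positivity
    filter_upwards [hunif _ hδ, hR, hmass.eventually (gt_mem_nhds (lt_add_one M))] with p hp1 hp2 hp3
    have htp : IsTest (F p) := .of_bound (hF1 p) hp2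
    rw [dist_zero_right, ← integral_sub (htp.integrable _) (ht₀.integrable _)]
    calc ‖∫ z, (F p z - F p₀ z) ∂(H (τ p))‖ ≤ ∫ z, ε / (M + 1) * χ z ∂(H (τ p)) := by
          refine norm_integral_le_of_norm_le ((hχ.const_mul _).integrable _) (ae_of_all _ fun z => ?_)
          rw [Real.norm_eq_abs]
          by_cases hz : |z| ≤ R
          · rw [hχR z hz, mul_one]
            exact (hp1 z (abs_le.1 hz)).le
          · rw [hp2 z (not_le.1 hz), hR.self_of_nhds z (not_le.1 hz)]
            simpa using mul_nonneg hδ.le (hχ0 z)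
      _ = ε / (M + 1) * ∫ z, χ z ∂(H (τ p)) := integral_const_mul _ _
      _ < ε / (M + 1) * (M + 1) := mul_lt_mul_of_pos_left hp3 hδ
      _ = ε := by field_simp
  have := hdiff.add hlim
  simpa [ContinuousAt] using this

/-- Riesz representation of a pointwise continuous curve of positive functionals. -/
theorem exists_vagueCurve (Λ : ℝ → (ℝ → ℝ) → ℝ)
    (hadd : ∀ t φ ψ, IsTest φ → IsTest ψ → Λ t (fun x => φ x + ψ x) = Λ t φ + Λ t ψ)
    (hsmul : ∀ t c φ, IsTest φ → Λ t (fun x => c * φ x) = c * Λ t φ)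
    (hpos : ∀ t φ, IsTest φ → (∀ x, 0 ≤ x → 0 ≤ φ x) → 0 ≤ Λ t φ)
    (hcont : ∀ φ, IsTest φ → Continuous fun t => Λ t φ) :
    ∃ H, VagueCurve H ∧ ∀ t φ, IsTest φ → ∫ x, φ x ∂(H t) = Λ t φ := by
  have test : ∀ f : CompactlySupportedContinuousMap ℝ ℝ, IsTest f := fun f =>
    ⟨f.continuous, f.hasCompactSupport⟩
  let L : ℝ → CompactlySupportedContinuousMap ℝ ℝ →ₚ[ℝ] ℝ := fun t =>
    PositiveLinearMap.mk₀
      { toFun := fun f => Λ t f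
        map_add' := fun f g => hadd t f g (test f) (test g)
        map_smul' := fun c f => hsmul t c f (test f) }
      (fun f hf => hpos t f (test f) fun x _ => hf x)
  have key : ∀ t φ, IsTest φ → ∫ x, φ x ∂(RealRMK.rieszMeasure (L t)) = Λ t φ := fun t φ hφ =>
    RealRMK.integral_rieszMeasure (L t) ⟨⟨φ, hφ.cont⟩, hφ.supp⟩
  have hfin : ∀ t, IsFiniteMeasureOnCompacts (RealRMK.rieszMeasure (L t)) := fun t => inferInstance
  refine ⟨fun t => RealRMK.rieszMeasure (L t), ⟨fun t => ?_, hfin, fun φ hφ => ?_⟩, key⟩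
  · have hf : ∀ n, IsTest fun x => tent n x * max 0 (-x) := fun n =>
      (isTest_tent n).mul_right (by fun_prop)
    have hz : ∀ n, ∀ᵐ x ∂(RealRMK.rieszMeasure (L t)), tent n x * max 0 (-x) = 0 := by
      intro n
      have h1 : ∀ x : ℝ, 0 ≤ x → tent n x * max 0 (-x) = 0 := fun x hx => by
        rw [max_eq_left (by linarith), mul_zero]
      have h2 : 0 ≤ Λ t fun x => -1 * (tent n x * max 0 (-x)) :=
        hpos t _ ((hf n).const_mul _) fun x hx => by rw [h1 x hx]; simp
      rw [hsmul t _ _ (hf n), ← key t _ (hf n)] at h2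
      have h3 : 0 ≤ fun x => tent n x * max 0 (-x) := fun x =>
        mul_nonneg (tent_nonneg _ _) (le_max_left _ _)
      have h4 : ∫ x, tent n x * max 0 (-x) ∂(RealRMK.rieszMeasure (L t)) = 0 :=
        le_antisymm (by linarith) (integral_nonneg h3)
      exact (integral_eq_zero_iff_of_nonneg h3 ((hf n).integrable _)).1 h4
    have h : ∀ᵐ x ∂(RealRMK.rieszMeasure (L t)), 0 ≤ x := by
      filter_upwards [ae_all_iff.2 hz] with x hx
      have hl := (tendsto_tent x).mul_const (max 0 (-x))
      simp only [hx] at hl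
      have h0 := tendsto_nhds_unique hl tendsto_const_nhds
      rw [one_mul] at h0
      have := le_max_right 0 (-x)
      linarith
    rw [ae_iff] at h
    simpa [not_le, Iio] using h
  · simpa only [key _ _ hφ] using hcont φ hφ

/-- The properties of the rate density `k s y z` (the regularized kernel divided by `z`, in
self-similar variables) used in the fixed point argument. -/
structure RegKernel (k : ℝ → ℝ → ℝ → ℝ) (w : ℝ → ℝ) (L c : ℝ) : Prop where
  cont : Continuous fun p : ℝ × ℝ × ℝ => k p.1 p.2.1 p.2.2
  nonneg : ∀ s y z, 0 ≤ k s y z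
  supp : ∀ s y z, k s y z ≠ 0 → 0 < y ∧ 0 < z ∧ z ≤ c * y
  le : ∀ s y z, k s y z ≤ L * w z
  L_nonneg : 0 ≤ L
  w_cont : Continuous w
  w_pos : ∀ x, 0 < w x
  w_anti : Antitone w

/-- The loss rate of a curve of measures. -/
def rate (k : ℝ → ℝ → ℝ → ℝ) (H : ℝ → Measure ℝ) (s x : ℝ) : ℝ := ∫ z, k s x z ∂(H s)

/-- The damping factor between times `s` and `t`. -/
def damp (k : ℝ → ℝ → ℝ → ℝ) (b : ℝ) (H : ℝ → Measure ℝ) (s t x : ℝ) : ℝ :=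
  exp (-(∫ ξ in s..t, (rate k H ξ x - b)))

/-- The weighted convolution of two measures, tested against `ψ`. -/
def gain (k : ℝ → ℝ → ℝ → ℝ) (s : ℝ) (μ ν : Measure ℝ) (ψ : ℝ → ℝ) : ℝ :=
  ∫ y, ∫ z, ψ (y + z) * k s y z ∂ν ∂μ

/-- The right-hand side of the mild formulation, tested against `φ`. -/
def duhamel (k : ℝ → ℝ → ℝ → ℝ) (b : ℝ) (h0 : Measure ℝ) (H : ℝ → Measure ℝ) (t : ℝ)
    (φ : ℝ → ℝ) : ℝ :=
  (∫ x, φ x * damp k b H 0 t x ∂h0) +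
    ∫ s in (0 : ℝ)..t, gain k s (H s) (H s) fun x => φ x * damp k b H s t x

namespace RegKernel

variable {k : ℝ → ℝ → ℝ → ℝ} {w : ℝ → ℝ} {L c b : ℝ} {H : ℝ → Measure ℝ} {h0 μ ν : Measure ℝ}

theorem cont_right (hk : RegKernel k w L c) (s y : ℝ) : Continuous (k s y) :=
  hk.cont.comp (by fun_prop : Continuous fun z : ℝ => (s, y, z))

theorem eq_zero_of_lt (hk : RegKernel k w L c) {s y z R : ℝ} (hR : |c| * |y| ≤ R) (hz : R < |z|) :
    k s y z = 0 := by
  by_contra hne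
  obtain ⟨h1, h2, h3⟩ := hk.supp s y z hne
  rw [abs_of_pos h2] at hz
  have : c * y ≤ |c| * |y| := by rw [← abs_mul]; exact le_abs_self _
  linarith

theorem isTest_right (hk : RegKernel k w L c) (s y : ℝ) : IsTest (k s y) :=
  .of_bound (hk.cont_right s y) fun _ hz => hk.eq_zero_of_lt le_rfl hz

theorem continuous_rate (hk : RegKernel k w L c) (hH : VagueCurve H) :
    Continuous fun p : ℝ × ℝ => rate k H p.1 p.2 := by
  refine hH.continuous_integral (F := fun p z => k p.1 p.2 z) continuous_fst ?_ fun p₀ => ?_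
  · exact hk.cont.comp (by fun_prop : Continuous fun q : (ℝ × ℝ) × ℝ => (q.1.1, q.1.2, q.2))
  · refine ⟨|c| * (|p₀.2| + 1), ?_⟩
    have : ∀ᶠ p : ℝ × ℝ in 𝓝 p₀, |p.2| < |p₀.2| + 1 :=
      (continuous_snd.abs.tendsto p₀).eventually (gt_mem_nhds (lt_add_one _))
    filter_upwards [this] with p hp z hz
    exact hk.eq_zero_of_lt (mul_le_mul_of_nonneg_left hp.le (abs_nonneg c)) hz

theorem continuous_rate_left (hk : RegKernel k w L c) (hH : VagueCurve H) (x : ℝ) :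
    Continuous fun s => rate k H s x :=
  (hk.continuous_rate hH).comp (by fun_prop : Continuous fun s : ℝ => (s, x))

theorem continuous_damp (hk : RegKernel k w L c) (hH : VagueCurve H) (b : ℝ) :
    Continuous fun p : ℝ × ℝ × ℝ => damp k b H p.1 p.2.1 p.2.2 := by
  have hI : Continuous fun q : ℝ × ℝ => ∫ ξ in (0 : ℝ)..q.1, (rate k H ξ q.2 - b) := by
    refine intervalIntegral.continuous_parametric_intervalIntegral_of_continuous
      (f := fun (q : ℝ × ℝ) ξ => rate k H ξ q.2 - b) ?_ continuous_fst
    exact ((hk.continuous_rate hH).comp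
      (by fun_prop : Continuous fun r : (ℝ × ℝ) × ℝ => (r.2, r.1.2))).sub continuous_const
  have hint : ∀ x u v, IntervalIntegrable (fun ξ => rate k H ξ x - b) volume u v := fun x u v =>
    ((hk.continuous_rate_left hH x).sub continuous_const).intervalIntegrable u v
  have e : (fun p : ℝ × ℝ × ℝ => damp k b H p.1 p.2.1 p.2.2) = fun p =>
      exp (-((∫ ξ in (0 : ℝ)..p.2.1, (rate k H ξ p.2.2 - b)) -
        ∫ ξ in (0 : ℝ)..p.1, (rate k H ξ p.2.2 - b))) := by
    funext p
    rw [damp, intervalIntegral.integral_interval_sub_left (hint _ _ _) (hint _ _ _)]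
  rw [e]
  have h1 := hI.comp (by fun_prop : Continuous fun p : ℝ × ℝ × ℝ => (p.2.1, p.2.2))
  have h2 := hI.comp (by fun_prop : Continuous fun p : ℝ × ℝ × ℝ => (p.1, p.2.2))
  exact (h1.sub h2).neg.rexp

theorem continuous_damp_right (hk : RegKernel k w L c) (hH : VagueCurve H) (b s t : ℝ) :
    Continuous (damp k b H s t) :=
  (hk.continuous_damp hH b).comp (by fun_prop : Continuous fun x : ℝ => (s, t, x))

theorem damp_le (hk : RegKernel k w L c) (hH : VagueCurve H) {s t T : ℝ} (hb : 0 ≤ b)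
    (hs : 0 ≤ s) (hst : s ≤ t) (htT : t ≤ T) (x : ℝ) :
    -(∫ ξ in s..t, (rate k H ξ x - b)) ≤ b * T := by
  have h : ∫ _ξ in s..t, -b ≤ ∫ ξ in s..t, (rate k H ξ x - b) := by
    refine intervalIntegral.integral_mono_on hst (by simp)
      (((hk.continuous_rate_left hH x).sub continuous_const).intervalIntegrable _ _) fun ξ _ => ?_
    have : 0 ≤ rate k H ξ x := integral_nonneg fun z => hk.nonneg _ _ _
    linarith
  rw [intervalIntegral.integral_const, smul_eq_mul] at h
  nlinarith

theorem gain_integrand_eq_zero (hk : RegKernel k w L c) {ψ : ℝ → ℝ} {R : ℝ}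
    (hψ : ∀ x, R < |x| → ψ x = 0) {s y z : ℝ} (h : R < |y| ∨ R < |z|) :
    ψ (y + z) * k s y z = 0 := by
  by_cases hne : k s y z = 0
  · rw [hne, mul_zero]
  obtain ⟨h1, h2, -⟩ := hk.supp s y z hne
  rw [hψ, zero_mul]
  rw [abs_of_pos h1, abs_of_pos h2] at h
  rw [abs_of_pos (add_pos h1 h2)]
  rcases h with h | h <;> linarith

theorem isTest_gain_integrand (hk : RegKernel k w L c) {ψ : ℝ → ℝ} (hψ : IsTest ψ) (s y : ℝ) :
    IsTest fun z => ψ (y + z) * k s y z := by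
  obtain ⟨R, -, hR⟩ := hψ.exists_bound
  exact .of_bound ((hψ.cont.comp (continuous_const.add continuous_id)).mul (hk.cont_right s y))
    fun z hz => hk.gain_integrand_eq_zero hR (.inr hz)

theorem continuous_gain_inner (hk : RegKernel k w L c) (hH : VagueCurve H) {P : Type*}
    [TopologicalSpace P] {τ : P → ℝ} (hτ : Continuous τ) {ψ : P → ℝ → ℝ}
    (hψ : Continuous (Function.uncurry ψ)) {R : ℝ} (hR : ∀ p x, R < |x| → ψ p x = 0) :
    Continuous fun q : P × ℝ => ∫ z, ψ q.1 (q.2 + z) * k (τ q.1) q.2 z ∂(H (τ q.1)) := by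
  refine hH.continuous_integral (F := fun q z => ψ q.1 (q.2 + z) * k (τ q.1) q.2 z)
    (hτ.comp continuous_fst) ?_ fun q₀ => ⟨R, .of_forall fun q z hz => ?_⟩
  · have h1 : Continuous fun r : (P × ℝ) × ℝ => ψ r.1.1 (r.1.2 + r.2) :=
      hψ.comp (by fun_prop : Continuous fun r : (P × ℝ) × ℝ => (r.1.1, r.1.2 + r.2))
    have h2 : Continuous fun r : (P × ℝ) × ℝ => k (τ r.1.1) r.1.2 r.2 :=
      hk.cont.comp (by fun_prop : Continuous fun r : (P × ℝ) × ℝ => (τ r.1.1, r.1.2, r.2))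
    exact h1.mul h2
  · exact hk.gain_integrand_eq_zero (hR q.1) (.inr hz)

theorem continuous_gain (hk : RegKernel k w L c) (hH : VagueCurve H) {P : Type*}
    [TopologicalSpace P] {τ : P → ℝ} (hτ : Continuous τ) {ψ : P → ℝ → ℝ}
    (hψ : Continuous (Function.uncurry ψ)) {R : ℝ} (hR : ∀ p x, R < |x| → ψ p x = 0) :
    Continuous fun p => gain k (τ p) (H (τ p)) (H (τ p)) (ψ p) := by
  refine hH.continuous_integral
    (F := fun p y => ∫ z, ψ p (y + z) * k (τ p) y z ∂(H (τ p))) hτ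
    (hk.continuous_gain_inner hH hτ hψ hR) fun p₀ => ⟨R, .of_forall fun p y hy => ?_⟩
  simp [hk.gain_integrand_eq_zero (hR p) (Or.inl hy)]

theorem isTest_gain_inner (hk : RegKernel k w L c) (hν : ν (Iio 0) = 0)
    [IsFiniteMeasureOnCompacts ν] {ψ : ℝ → ℝ} (hψ : IsTest ψ) (s : ℝ) :
    IsTest fun y => ∫ z, ψ (y + z) * k s y z ∂ν := by
  obtain ⟨R, -, hR⟩ := hψ.exists_bound
  refine .of_bound (R := R) ?_ fun y hy => ?_
  · have := hk.continuous_gain_inner (VagueCurve.const hν) (P := ℝ) (τ := fun _ => s)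
      continuous_const (ψ := fun _ => ψ) (hψ.cont.comp continuous_snd) (fun _ => hR)
    exact this.comp (by fun_prop : Continuous fun y : ℝ => ((0 : ℝ), y))
  · simp [hk.gain_integrand_eq_zero hR (Or.inl hy)]

theorem gain_add (hk : RegKernel k w L c) (hν : ν (Iio 0) = 0) [IsFiniteMeasureOnCompacts ν]
    [IsFiniteMeasureOnCompacts μ] {φ ψ : ℝ → ℝ} (hφ : IsTest φ) (hψ : IsTest ψ) (s : ℝ) :
    gain k s μ ν (fun x => φ x + ψ x) = gain k s μ ν φ + gain k s μ ν ψ := by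
  unfold gain
  rw [← integral_add ((hk.isTest_gain_inner hν hφ s).integrable μ)
    ((hk.isTest_gain_inner hν hψ s).integrable μ)]
  refine integral_congr_ae (ae_of_all _ fun y => ?_)
  simp only [add_mul]
  exact integral_add ((hk.isTest_gain_integrand hφ s y).integrable ν)
    ((hk.isTest_gain_integrand hψ s y).integrable ν)

theorem gain_const_mul (s a : ℝ) (φ : ℝ → ℝ) :
    gain k s μ ν (fun x => a * φ x) = a * gain k s μ ν φ := by
  simp only [gain, mul_assoc, integral_const_mul]

theorem gain_mono (hk : RegKernel k w L c) (hν : ν (Iio 0) = 0) [IsFiniteMeasureOnCompacts ν]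
    [IsFiniteMeasureOnCompacts μ] {φ ψ : ℝ → ℝ} (hφ : IsTest φ) (hψ : IsTest ψ) (s : ℝ)
    (h : ∀ x, 0 ≤ x → φ x ≤ ψ x) : gain k s μ ν φ ≤ gain k s μ ν ψ := by
  refine integral_mono ((hk.isTest_gain_inner hν hφ s).integrable μ)
    ((hk.isTest_gain_inner hν hψ s).integrable μ) fun y => ?_
  refine integral_mono ((hk.isTest_gain_integrand hφ s y).integrable ν)
    ((hk.isTest_gain_integrand hψ s y).integrable ν) fun z => ?_
  by_cases hne : k s y z = 0
  · simp [hne]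
  obtain ⟨h1, h2, -⟩ := hk.supp s y z hne
  exact mul_le_mul_of_nonneg_right (h _ (add_pos h1 h2).le) (hk.nonneg _ _ _)

theorem gain_nonneg (hk : RegKernel k w L c) {ψ : ℝ → ℝ} (s : ℝ)
    (h : ∀ x, 0 ≤ x → 0 ≤ ψ x) : 0 ≤ gain k s μ ν ψ := by
  refine integral_nonneg fun y => integral_nonneg fun z => ?_
  by_cases hne : k s y z = 0
  · simp [hne]
  obtain ⟨h1, h2, -⟩ := hk.supp s y z hne
  exact mul_nonneg (h _ (add_pos h1 h2).le) (hk.nonneg _ _ _)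

theorem abs_gain_le (hk : RegKernel k w L c) {ψ f g : ℝ → ℝ} (s : ℝ)
    (hf : Integrable f μ) (hg : Integrable g ν) (hf0 : ∀ y, 0 ≤ f y) (hg0 : ∀ z, 0 ≤ g z)
    (h : ∀ y z, 0 < y → 0 < z → |ψ (y + z)| * k s y z ≤ f y * (L * g z)) :
    |gain k s μ ν ψ| ≤ L * (∫ y, f y ∂μ) * ∫ z, g z ∂ν := by
  have hin : ∀ y, ‖∫ z, ψ (y + z) * k s y z ∂ν‖ ≤ f y * (L * ∫ z, g z ∂ν) := by
    intro y
    rw [← integral_const_mul, ← integral_const_mul]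
    refine norm_integral_le_of_norm_le ((hg.const_mul L).const_mul (f y))
      (ae_of_all _ fun z => ?_)
    rw [Real.norm_eq_abs, abs_mul, abs_of_nonneg (hk.nonneg s y z)]
    by_cases hne : k s y z = 0
    · rw [hne, mul_zero]
      exact mul_nonneg (hf0 y) (mul_nonneg hk.L_nonneg (hg0 z))
    obtain ⟨h1, h2, -⟩ := hk.supp s y z hne
    exact h y z h1 h2
  calc |gain k s μ ν ψ| ≤ ∫ y, f y * (L * ∫ z, g z ∂ν) ∂μ :=
        norm_integral_le_of_norm_le (hf.mul_const _) (ae_of_all _ hin)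
    _ = L * (∫ y, f y ∂μ) * ∫ z, g z ∂ν := by rw [integral_mul_const]; ring

end RegKernel

theorem damp_nonneg (k : ℝ → ℝ → ℝ → ℝ) (b : ℝ) (H : ℝ → Measure ℝ) (s t x : ℝ) :
    0 ≤ damp k b H s t x := (exp_pos _).le

/-- `μ` and `ν` are at distance at most `d` in the total variation norm weighted by `w`. -/
def WDist (w : ℝ → ℝ) (μ ν : Measure ℝ) (d : ℝ) : Prop :=
  ∀ φ, IsTest φ → (∀ x, |φ x| ≤ w x) → |∫ x, φ x ∂μ - ∫ x, φ x ∂ν| ≤ d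

theorem WDist.nonneg {w : ℝ → ℝ} {μ ν : Measure ℝ} {d : ℝ} (h : WDist w μ ν d)
    (hw : ∀ x, 0 < w x) : 0 ≤ d := by
  have := h (fun _ => 0) (.of_bound continuous_const (R := 0) fun _ _ => rfl)
    fun x => by simpa using (hw x).le
  simpa using this

theorem WDist.of_le_mul {w : ℝ → ℝ} {μ ν : Measure ℝ} {d a : ℝ} (h : WDist w μ ν d)
    (ha : 0 ≤ a) {φ : ℝ → ℝ} (hφ : IsTest φ) (hle : ∀ x, |φ x| ≤ a * w x) :
    |∫ x, φ x ∂μ - ∫ x, φ x ∂ν| ≤ a * d := by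
  rcases ha.eq_or_lt with rfl | ha
  · have : φ = fun _ => 0 := funext fun x => by simpa using hle x
    simp [this]
  have := h _ (hφ.const_mul a⁻¹) fun x => by
    rw [abs_mul, abs_of_pos (inv_pos.2 ha), inv_mul_le_iff₀ ha]
    exact hle x
  rwa [integral_const_mul, integral_const_mul, ← mul_sub, abs_mul, abs_of_pos (inv_pos.2 ha),
    inv_mul_le_iff₀ ha] at this

theorem exists_le_mul_weight {w φ : ℝ → ℝ} (hw : Continuous w) (hw0 : ∀ x, 0 < w x)
    (hφ : IsTest φ) : ∃ a > 0, ∀ x, |φ x| ≤ a * w x := by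
  obtain ⟨a, ha⟩ := (hφ.mul_right (hw.inv₀ fun x => (hw0 x).ne')).supp.exists_bound_of_continuous
    (hφ.mul_right (hw.inv₀ fun x => (hw0 x).ne')).cont
  refine ⟨max a 1, by positivity, fun x => ?_⟩
  have h := ha x
  rw [Real.norm_eq_abs, abs_mul, Pi.inv_apply, abs_of_pos (inv_pos.2 (hw0 x)), ← div_eq_mul_inv,
    div_le_iff₀ (hw0 x)] at h
  exact h.trans (mul_le_mul_of_nonneg_right (le_max_left _ _) (hw0 x).le)

theorem abs_integral_le_of_abs_le {μ : Measure ℝ} {f g : ℝ → ℝ} (hg : Integrable g μ)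
    (h : ∀ x, |f x| ≤ g x) : |∫ x, f x ∂μ| ≤ ∫ x, g x ∂μ := by
  rw [← Real.norm_eq_abs]
  exact norm_integral_le_of_norm_le hg (ae_of_all _ h)

theorem abs_exp_sub_exp_le {u v m : ℝ} (hu : u ≤ m) (hv : v ≤ m) :
    |exp u - exp v| ≤ exp m * |u - v| := by
  have key : ∀ a b : ℝ, b ≤ a → a ≤ m → |exp a - exp b| ≤ exp m * |a - b| := by
    intro a b hba ham
    rw [abs_of_nonneg (sub_nonneg.2 (exp_le_exp.2 hba)), abs_of_nonneg (sub_nonneg.2 hba)]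
    have h1 : exp b = exp a * exp (b - a) := by rw [← exp_add]; ring_nf
    have h2 := add_one_le_exp (b - a)
    calc exp a - exp b = exp a * (1 - exp (b - a)) := by rw [h1]; ring
      _ ≤ exp a * (a - b) := mul_le_mul_of_nonneg_left (by linarith) (exp_pos a).le
      _ ≤ exp m * (a - b) := mul_le_mul_of_nonneg_right (exp_le_exp.2 ham) (sub_nonneg.2 hba)
  rcases le_total v u with h | h
  · exact key u v h hu
  · rw [abs_sub_comm, abs_sub_comm u v]; exact key v u h hv

namespace RegKernel

variable {k : ℝ → ℝ → ℝ → ℝ} {w : ℝ → ℝ} {L c b : ℝ} {H H' : ℝ → Measure ℝ} {h0 μ ν : Measure ℝ}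

theorem isTest_mul_damp (hk : RegKernel k w L c) (hH : VagueCurve H) {φ : ℝ → ℝ} (hφ : IsTest φ)
    (s t : ℝ) : IsTest fun x => φ x * damp k b H s t x :=
  hφ.mul_right (hk.continuous_damp_right hH b s t)

theorem continuous_gain_damp (hk : RegKernel k w L c) (hH : VagueCurve H) {φ : ℝ → ℝ}
    (hφ : IsTest φ) : Continuous fun p : ℝ × ℝ =>
      gain k p.2 (H p.2) (H p.2) fun x => φ x * damp k b H p.2 p.1 x := by
  obtain ⟨R, -, hR⟩ := hφ.exists_bound
  refine hk.continuous_gain hH (τ := fun p : ℝ × ℝ => p.2) continuous_snd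
    (ψ := fun p x => φ x * damp k b H p.2 p.1 x) (R := R) ?_ fun p x hx => by rw [hR x hx, zero_mul]
  exact (hφ.cont.comp continuous_snd).mul ((hk.continuous_damp hH b).comp
    (by fun_prop : Continuous fun q : (ℝ × ℝ) × ℝ => (q.1.2, q.1.1, q.2)))

theorem continuous_gain_damp_left (hk : RegKernel k w L c) (hH : VagueCurve H) {φ : ℝ → ℝ}
    (hφ : IsTest φ) (t : ℝ) : Continuous fun s =>
      gain k s (H s) (H s) fun x => φ x * damp k b H s t x :=
  (hk.continuous_gain_damp hH hφ).comp (by fun_prop : Continuous fun s : ℝ => (t, s))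

theorem continuous_duhamel (hk : RegKernel k w L c) (hH : VagueCurve H) (hh0 : h0 (Iio 0) = 0)
    [IsFiniteMeasureOnCompacts h0] {φ : ℝ → ℝ} (hφ : IsTest φ) :
    Continuous fun t => duhamel k b h0 H t φ := by
  obtain ⟨R, -, hR⟩ := hφ.exists_bound
  refine Continuous.add ?_ ?_
  · refine (VagueCurve.const hh0).continuous_integral (τ := id)
      (F := fun t x => φ x * damp k b H 0 t x) continuous_id ?_
      fun _ => ⟨R, .of_forall fun t x hx => by rw [hR x hx, zero_mul]⟩
    exact (hφ.cont.comp continuous_snd).mul ((hk.continuous_damp hH b).comp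
      (by fun_prop : Continuous fun q : ℝ × ℝ => ((0 : ℝ), q.1, q.2)))
  · exact intervalIntegral.continuous_parametric_intervalIntegral_of_continuous
      (f := fun t s => gain k s (H s) (H s) fun x => φ x * damp k b H s t x)
      (hk.continuous_gain_damp hH hφ) continuous_id

theorem duhamel_add (hk : RegKernel k w L c) (hH : VagueCurve H)
    [IsFiniteMeasureOnCompacts h0] {φ ψ : ℝ → ℝ} (hφ : IsTest φ) (hψ : IsTest ψ) (t : ℝ) :
    duhamel k b h0 H t (fun x => φ x + ψ x) = duhamel k b h0 H t φ + duhamel k b h0 H t ψ := by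
  have := hH.fin
  simp only [duhamel, add_mul]
  rw [integral_add ((hk.isTest_mul_damp hH hφ _ _).integrable _)
    ((hk.isTest_mul_damp hH hψ _ _).integrable _)]
  simp only [hk.gain_add (hH.null _) (hk.isTest_mul_damp hH hφ _ t) (hk.isTest_mul_damp hH hψ _ t)]
  rw [intervalIntegral.integral_add
    ((hk.continuous_gain_damp_left hH hφ t).intervalIntegrable _ _)
    ((hk.continuous_gain_damp_left hH hψ t).intervalIntegrable _ _)]
  ring

theorem duhamel_const_mul (a t : ℝ) (φ : ℝ → ℝ) :
    duhamel k b h0 H t (fun x => a * φ x) = a * duhamel k b h0 H t φ := by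
  simp only [duhamel, mul_assoc, integral_const_mul, gain_const_mul,
    intervalIntegral.integral_const_mul]
  ring

theorem duhamel_nonneg (hk : RegKernel k w L c) (hh0 : h0 (Iio 0) = 0) {t : ℝ} (ht : 0 ≤ t)
    {φ : ℝ → ℝ} (h : ∀ x, 0 ≤ x → 0 ≤ φ x) : 0 ≤ duhamel k b h0 H t φ := by
  refine add_nonneg (integral_nonneg_of_ae ?_)
    (intervalIntegral.integral_nonneg ht fun s _ => hk.gain_nonneg s fun x hx => ?_)
  · filter_upwards [ae_nonneg_of_null hh0] with x hx
    exact mul_nonneg (h x hx) (damp_nonneg _ _ _ _ _ _)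
  · exact mul_nonneg (h x hx) (damp_nonneg _ _ _ _ _ _)

theorem duhamel_le (hk : RegKernel k w L c) (hH : VagueCurve H) (hh0 : h0 (Iio 0) = 0)
    [IsFiniteMeasureOnCompacts h0] (hb : 0 ≤ b) {t T G : ℝ} (ht : 0 ≤ t) (htT : t ≤ T)
    {φ : ℝ → ℝ} (hφ : IsTest φ) (h : ∀ x, 0 ≤ x → 0 ≤ φ x)
    (hG : ∀ s, 0 < s → s < t → gain k s (H s) (H s) φ ≤ G) :
    duhamel k b h0 H t φ ≤ exp (b * T) * (∫ x, φ x ∂h0 + t * G) := by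
  have := hH.fin
  have hd : ∀ s x, 0 ≤ s → s ≤ t → damp k b H s t x ≤ exp (b * T) := fun s x hs hst =>
    exp_le_exp.2 (hk.damp_le hH hb hs hst htT x)
  have h1 : ∫ x, φ x * damp k b H 0 t x ∂h0 ≤ exp (b * T) * ∫ x, φ x ∂h0 := by
    rw [← integral_const_mul]
    refine integral_mono_ae ((hk.isTest_mul_damp hH hφ _ _).integrable _)
      ((hφ.const_mul _).integrable _) ?_
    filter_upwards [ae_nonneg_of_null hh0] with x hx
    rw [mul_comm]
    exact mul_le_mul_of_nonneg_right (hd 0 x le_rfl ht) (h x hx)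
  have h2 : ∫ s in (0 : ℝ)..t, gain k s (H s) (H s) (fun x => φ x * damp k b H s t x) ≤
      ∫ _s in (0 : ℝ)..t, exp (b * T) * G := by
    refine intervalIntegral.integral_mono_on_of_le_Ioo ht
      ((hk.continuous_gain_damp_left hH hφ t).intervalIntegrable _ _) (by simp) fun s hs => ?_
    refine (hk.gain_mono (hH.null s) (hk.isTest_mul_damp hH hφ _ _) (hφ.const_mul (exp (b * T))) s
      fun x hx => ?_).trans ?_
    · rw [mul_comm]
      exact mul_le_mul_of_nonneg_right (hd s x hs.1.le hs.2.le) (h x hx)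
    · rw [gain_const_mul]
      exact mul_le_mul_of_nonneg_left (hG s hs.1 hs.2) (exp_pos _).le
  rw [intervalIntegral.integral_const, smul_eq_mul, sub_zero] at h2
  unfold duhamel
  nlinarith

theorem abs_rate_sub_le (hk : RegKernel k w L c) {s d : ℝ} (hd : WDist w (H s) (H' s) d) (x : ℝ) :
    |rate k H s x - rate k H' s x| ≤ L * d :=
  hd.of_le_mul hk.L_nonneg (hk.isTest_right s x) fun z => by
    rw [abs_of_nonneg (hk.nonneg _ _ _)]; exact hk.le s x z

theorem abs_damp_sub_le (hk : RegKernel k w L c) (hH : VagueCurve H) (hH' : VagueCurve H')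
    (hb : 0 ≤ b) {s t T d : ℝ} (hs : 0 ≤ s) (hst : s ≤ t) (htT : t ≤ T)
    (hd : ∀ s, WDist w (H s) (H' s) d) (x : ℝ) :
    |damp k b H s t x - damp k b H' s t x| ≤ exp (b * T) * (T * (L * d)) := by
  have hLd : 0 ≤ L * d := mul_nonneg hk.L_nonneg ((hd 0).nonneg hk.w_pos)
  refine (abs_exp_sub_exp_le (hk.damp_le hH hb hs hst htT x)
    (hk.damp_le hH' hb hs hst htT x)).trans (mul_le_mul_of_nonneg_left ?_ (exp_pos _).le)
  have hint : ∀ {F : ℝ → Measure ℝ}, VagueCurve F →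
      IntervalIntegrable (fun ξ => rate k F ξ x - b) volume s t := fun hF =>
    ((hk.continuous_rate_left hF x).sub continuous_const).intervalIntegrable _ _
  rw [neg_sub_neg, ← intervalIntegral.integral_sub (hint hH') (hint hH), ← Real.norm_eq_abs]
  refine (intervalIntegral.norm_integral_le_of_norm_le_const (C := L * d) fun ξ _ => ?_).trans ?_
  · rw [Real.norm_eq_abs, sub_sub_sub_cancel_right, abs_sub_comm]
    exact hk.abs_rate_sub_le (hd ξ) x
  · rw [abs_of_nonneg (sub_nonneg.2 hst), mul_comm]
    exact mul_le_mul_of_nonneg_right (by linarith) hLd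

theorem abs_gain_sub_le (hk : RegKernel k w L c) (hμ : μ (Iio 0) = 0) (hν : ν (Iio 0) = 0)
    [IsFiniteMeasureOnCompacts μ] [IsFiniteMeasureOnCompacts ν] {B d δ m s : ℝ}
    (hμB : Integrable w μ ∧ ∫ x, w x ∂μ ≤ B) (hνB : Integrable w ν ∧ ∫ x, w x ∂ν ≤ B)
    (hd : WDist w μ ν d) {ψ ψ' : ℝ → ℝ} (hψ : IsTest ψ) (hψ' : IsTest ψ') (hδ : 0 ≤ δ)
    (hm : 0 ≤ m) (hdiff : ∀ x, |ψ x - ψ' x| ≤ δ * w x) (hψm : ∀ x, |ψ' x| ≤ m * w x) :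
    |gain k s μ μ ψ - gain k s ν ν ψ'| ≤ δ * (L * B ^ 2) + 2 * (m * L * B * d) := by
  have hL := hk.L_nonneg
  have hw0 : ∀ x, 0 ≤ w x := fun x => (hk.w_pos x).le
  have hB : 0 ≤ B := (integral_nonneg hw0).trans hμB.2
  have hμ0 : 0 ≤ ∫ x, w x ∂μ := integral_nonneg hw0
  have hd0 : 0 ≤ d := hd.nonneg hk.w_pos
  have hmLd : 0 ≤ m * (L * d) := by positivity
  have hbound : ∀ (χ : ℝ → ℝ) (a : ℝ), 0 ≤ a → (∀ x, |χ x| ≤ a * w x) → ∀ y z,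
      |χ (y + z) * k s y z| ≤ a * w y * (L * w z) := by
    intro χ a ha hχ y z
    rw [abs_mul, abs_of_nonneg (hk.nonneg s y z)]
    by_cases hne : k s y z = 0
    · rw [hne, mul_zero]
      exact mul_nonneg (mul_nonneg ha (hw0 y)) (mul_nonneg hL (hw0 z))
    obtain ⟨h1, h2, -⟩ := hk.supp s y z hne
    refine mul_le_mul ((hχ _).trans (mul_le_mul_of_nonneg_left (hk.w_anti ?_) ha)) (hk.le s y z)
      (hk.nonneg _ _ _) (mul_nonneg ha (hw0 y))
    linarith
  have e1 : |gain k s μ μ ψ - gain k s μ μ ψ'| ≤ δ * (L * B ^ 2) := by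
    have e : gain k s μ μ ψ - gain k s μ μ ψ' = gain k s μ μ fun x => ψ x - ψ' x := by
      have := hk.gain_add (s := s) (μ := μ) hμ (hψ.sub hψ') hψ'
      simp only [sub_add_cancel] at this
      rw [this]; ring
    rw [e]
    refine (hk.abs_gain_le s (hμB.1.const_mul δ) hμB.1 (fun y => mul_nonneg hδ (hw0 y)) hw0
      fun y z _ _ => ?_).trans ?_
    · have := hbound _ δ hδ hdiff y z
      rwa [abs_mul, abs_of_nonneg (hk.nonneg s y z)] at this
    · rw [integral_const_mul]
      have := mul_le_mul hμB.2 hμB.2 hμ0 hB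
      have := mul_le_mul_of_nonneg_left this (mul_nonneg hδ hL)
      nlinarith
  have e2 : |gain k s μ μ ψ' - gain k s μ ν ψ'| ≤ m * L * B * d := by
    unfold gain
    rw [← integral_sub ((hk.isTest_gain_inner hμ hψ' s).integrable μ)
      ((hk.isTest_gain_inner hν hψ' s).integrable μ)]
    refine (abs_integral_le_of_abs_le (hμB.1.mul_const (m * (L * d))) fun y => ?_).trans ?_
    · have := hd.of_le_mul (a := m * w y * L) (by have := hw0 y; positivity)
        (hk.isTest_gain_integrand hψ' s y) fun z =>
        (hbound ψ' m hm hψm y z).trans_eq (by ring)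
      exact this.trans_eq (by ring)
    rw [integral_mul_const]
    calc _ ≤ B * (m * (L * d)) := mul_le_mul_of_nonneg_right hμB.2 hmLd
      _ = _ := by ring
  have e3 : |gain k s μ ν ψ' - gain k s ν ν ψ'| ≤ m * L * B * d := by
    refine hd.of_le_mul (by positivity) (hk.isTest_gain_inner hν hψ' s) fun y => ?_
    have hle : |∫ z, ψ' (y + z) * k s y z ∂ν| ≤ ∫ z, m * w y * (L * w z) ∂ν :=
      abs_integral_le_of_abs_le ((hνB.1.const_mul L).const_mul _) (hbound ψ' m hm hψm y)
    rw [integral_const_mul, integral_const_mul] at hle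
    refine hle.trans ?_
    have : 0 ≤ m * w y * L := by have := hw0 y; positivity
    calc m * w y * (L * ∫ z, w z ∂ν) = m * w y * L * ∫ z, w z ∂ν := by ring
      _ ≤ m * w y * L * B := mul_le_mul_of_nonneg_left hνB.2 this
      _ = m * L * B * w y := by ring
  calc |gain k s μ μ ψ - gain k s ν ν ψ'|
      = |(gain k s μ μ ψ - gain k s μ μ ψ') + (gain k s μ μ ψ' - gain k s μ ν ψ') +
          (gain k s μ ν ψ' - gain k s ν ν ψ')| := by ring_nf
    _ ≤ δ * (L * B ^ 2) + m * L * B * d + m * L * B * d :=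
        (abs_add_three _ _ _).trans (add_le_add (add_le_add e1 e2) e3)
    _ = _ := by ring

/-- The right-hand side of the mild formulation is Lipschitz in the weighted norm, with a constant
which is small for short times. -/
theorem abs_duhamel_sub_le (hk : RegKernel k w L c) (hH : VagueCurve H) (hH' : VagueCurve H')
    (hb : 0 ≤ b) {B N T t d : ℝ} [IsFiniteMeasureOnCompacts h0]
    (hHB : ∀ s, Integrable w (H s) ∧ ∫ x, w x ∂(H s) ≤ B)
    (hHB' : ∀ s, Integrable w (H' s) ∧ ∫ x, w x ∂(H' s) ≤ B)
    (hN : Integrable w h0 ∧ ∫ x, w x ∂h0 ≤ N) (ht : 0 ≤ t) (htT : t ≤ T)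
    (hd : ∀ s, WDist w (H s) (H' s) d) {φ : ℝ → ℝ} (hφ : IsTest φ) (hφw : ∀ x, |φ x| ≤ w x) :
    |duhamel k b h0 H t φ - duhamel k b h0 H' t φ| ≤
      exp (b * T) * T * (L * N + T * L ^ 2 * B ^ 2 + 2 * L * B) * d := by
  have := hH.fin
  have := hH'.fin
  have hL := hk.L_nonneg
  have hw0 : ∀ x, 0 ≤ w x := fun x => (hk.w_pos x).le
  have hd0 : 0 ≤ d := (hd 0).nonneg hk.w_pos
  have hB : 0 ≤ B := (integral_nonneg hw0).trans (hHB 0).2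
  have hT : 0 ≤ T := ht.trans htT
  set E := exp (b * T) with hE
  have hE0 : 0 < E := exp_pos _
  set δ := E * (T * (L * d)) with hδ
  have hδ0 : 0 ≤ δ := by positivity
  have hdiff : ∀ s, 0 ≤ s → s ≤ t → ∀ x,
      |φ x * damp k b H s t x - φ x * damp k b H' s t x| ≤ δ * w x := by
    intro s hs hst x
    rw [← mul_sub, abs_mul, mul_comm]
    exact mul_le_mul (hk.abs_damp_sub_le hH hH' hb hs hst htT hd x) (hφw x) (abs_nonneg _) hδ0
  have h1 : |∫ x, φ x * damp k b H 0 t x ∂h0 - ∫ x, φ x * damp k b H' 0 t x ∂h0| ≤ δ * N := by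
    rw [← integral_sub ((hk.isTest_mul_damp hH hφ _ _).integrable _)
      ((hk.isTest_mul_damp hH' hφ _ _).integrable _)]
    refine (abs_integral_le_of_abs_le (hN.1.const_mul δ) (hdiff 0 le_rfl ht)).trans ?_
    rw [integral_const_mul]
    exact mul_le_mul_of_nonneg_left hN.2 hδ0
  have hG0 : 0 ≤ δ * (L * B ^ 2) + 2 * (E * L * B * d) := by positivity
  have h2 : |(∫ s in (0 : ℝ)..t, gain k s (H s) (H s) fun x => φ x * damp k b H s t x) -
      ∫ s in (0 : ℝ)..t, gain k s (H' s) (H' s) fun x => φ x * damp k b H' s t x| ≤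
      (δ * (L * B ^ 2) + 2 * (E * L * B * d)) * T := by
    rw [← intervalIntegral.integral_sub
      ((hk.continuous_gain_damp_left hH hφ t).intervalIntegrable _ _)
      ((hk.continuous_gain_damp_left hH' hφ t).intervalIntegrable _ _), ← Real.norm_eq_abs]
    refine (intervalIntegral.norm_integral_le_of_norm_le_const
      (C := δ * (L * B ^ 2) + 2 * (E * L * B * d)) fun s hs => ?_).trans ?_
    · rw [uIoc_of_le ht] at hs
      refine hk.abs_gain_sub_le (hH.null s) (hH'.null s) (hHB s) (hHB' s) (hd s)
        (hk.isTest_mul_damp hH hφ _ _) (hk.isTest_mul_damp hH' hφ _ _) hδ0 hE0.le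
        (hdiff s hs.1.le hs.2) fun x => ?_
      rw [abs_mul, abs_of_nonneg (damp_nonneg _ _ _ _ _ _), mul_comm]
      exact mul_le_mul (exp_le_exp.2 (hk.damp_le hH' hb hs.1.le hs.2 htT x)) (hφw x)
        (abs_nonneg _) hE0.le
    · rw [sub_zero, abs_of_nonneg ht]
      exact mul_le_mul_of_nonneg_left htT hG0
  calc _ = |(∫ x, φ x * damp k b H 0 t x ∂h0 - ∫ x, φ x * damp k b H' 0 t x ∂h0) +
        ((∫ s in (0 : ℝ)..t, gain k s (H s) (H s) fun x => φ x * damp k b H s t x) -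
          ∫ s in (0 : ℝ)..t, gain k s (H' s) (H' s) fun x => φ x * damp k b H' s t x)| := by
        unfold duhamel; ring_nf
    _ ≤ δ * N + (δ * (L * B ^ 2) + 2 * (E * L * B * d)) * T :=
        (abs_add_le _ _).trans (add_le_add h1 h2)
    _ = _ := by rw [hδ]; ring

end RegKernel

/-- Projection of the line onto `[0, T]`. -/
def clamp (T t : ℝ) : ℝ := max 0 (min t T)

theorem continuous_clamp (T : ℝ) : Continuous (clamp T) := by unfold clamp; fun_prop

theorem clamp_nonneg (T t : ℝ) : 0 ≤ clamp T t := le_max_left _ _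

theorem clamp_le {T : ℝ} (hT : 0 ≤ T) (t : ℝ) : clamp T t ≤ T := max_le hT (min_le_right _ _)

theorem clamp_mem {T : ℝ} (hT : 0 ≤ T) (t : ℝ) : clamp T t ∈ Icc 0 T :=
  ⟨clamp_nonneg T t, clamp_le hT t⟩

theorem clamp_of_mem {T t : ℝ} (h : t ∈ Icc 0 T) : clamp T t = t := by
  rw [clamp, min_eq_left h.2, max_eq_right h.1]

/-- A vaguely continuous curve whose `w`-weighted masses are bounded by `B`. -/
structure BoundedCurve (w : ℝ → ℝ) (B : ℝ) (H : ℝ → Measure ℝ) : Prop where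
  curve : VagueCurve H
  bound : ∀ s, Integrable w (H s) ∧ ∫ x, w x ∂(H s) ≤ B

theorem abs_integral_le_of_abs_le_weight {w φ : ℝ → ℝ} {B : ℝ} {μ : Measure ℝ}
    (hμ : Integrable w μ ∧ ∫ x, w x ∂μ ≤ B) (hφ : ∀ x, |φ x| ≤ w x) : |∫ x, φ x ∂μ| ≤ B :=
  (abs_integral_le_of_abs_le hμ.1 hφ).trans hμ.2

theorem wdist_two_mul {w : ℝ → ℝ} {B : ℝ} {μ ν : Measure ℝ}
    (hμ : Integrable w μ ∧ ∫ x, w x ∂μ ≤ B) (hν : Integrable w ν ∧ ∫ x, w x ∂ν ≤ B) :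
    WDist w μ ν (2 * B) := fun φ _ hφw => by
  refine (abs_sub _ _).trans ?_
  have h1 := abs_integral_le_of_abs_le_weight hμ hφw
  have h2 := abs_integral_le_of_abs_le_weight hν hφw
  linarith

/-- A curve solving the mild equation on `[0, T]`, extended by constants outside. -/
def IsClampedSolution (k : ℝ → ℝ → ℝ → ℝ) (b T : ℝ) (h0 : Measure ℝ) (H : ℝ → Measure ℝ) : Prop :=
  ∀ t φ, IsTest φ → ∫ x, φ x ∂(H t) = duhamel k b h0 H (clamp T t) φ

theorem measure_eq_of_integral_eq {μ ν : Measure ℝ} [IsFiniteMeasureOnCompacts μ]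
    [IsFiniteMeasureOnCompacts ν] (h : ∀ φ, IsTest φ → ∫ x, φ x ∂μ = ∫ x, φ x ∂ν) : μ = ν :=
  Measure.ext_of_integral_eq_on_compactlySupported fun f =>
    h f ⟨f.continuous, f.hasCompactSupport⟩

/-- A geometric Cauchy sequence of curves converges. -/
theorem exists_limit_curve {w : ℝ → ℝ} (hw : Continuous w) (hw0 : ∀ x, 0 < w x) {B D : ℝ}
    {u : ℕ → ℝ → Measure ℝ} (hu : ∀ n, BoundedCurve w B (u n))
    (hd : ∀ n s, WDist w (u n s) (u (n + 1) s) (D * (1 / 2) ^ n)) :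
    ∃ H, BoundedCurve w B H ∧ (∀ n s, WDist w (u n s) (H s) (2 * D * (1 / 2) ^ n)) ∧
      ∀ s φ, IsTest φ → Tendsto (fun n => ∫ x, φ x ∂(u n s)) atTop (𝓝 (∫ x, φ x ∂(H s))) := by
  have hfin : ∀ n s, IsFiniteMeasureOnCompacts (u n s) := fun n => (hu n).curve.fin
  have hgeo : ∀ φ, IsTest φ → ∀ a, 0 ≤ a → (∀ x, |φ x| ≤ a * w x) → ∀ s n,
      dist (∫ x, φ x ∂(u n s)) (∫ x, φ x ∂(u (n + 1) s)) ≤ a * D * (1 / 2) ^ n := by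
    intro φ hφ a ha hle s n
    rw [Real.dist_eq, mul_assoc]
    exact (hd n s).of_le_mul ha hφ hle
  let Λ : ℝ → (ℝ → ℝ) → ℝ := fun s φ => limUnder atTop fun n => ∫ x, φ x ∂(u n s)
  have hΛ : ∀ s φ, IsTest φ → Tendsto (fun n => ∫ x, φ x ∂(u n s)) atTop (𝓝 (Λ s φ)) := by
    intro s φ hφ
    obtain ⟨a, ha, hle⟩ := exists_le_mul_weight hw hw0 hφ
    exact (cauchySeq_of_le_geometric _ _ (by norm_num) (hgeo φ hφ a ha.le hle s)).tendsto_limUnder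
  have hclose : ∀ φ, IsTest φ → ∀ a, 0 ≤ a → (∀ x, |φ x| ≤ a * w x) → ∀ s n,
      dist (∫ x, φ x ∂(u n s)) (Λ s φ) ≤ a * (2 * D * (1 / 2) ^ n) := by
    intro φ hφ a ha hle s n
    have := dist_le_of_le_geometric_of_tendsto _ _ (by norm_num) (hgeo φ hφ a ha hle s)
      (hΛ s φ hφ) n
    exact this.trans_eq (by ring)
  obtain ⟨H, hH, hHΛ⟩ := exists_vagueCurve Λ
    (fun s φ ψ hφ hψ => by
      refine tendsto_nhds_unique (hΛ s _ (hφ.add hψ)) (((hΛ s φ hφ).add (hΛ s ψ hψ)).congr fun n => ?_)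
      exact (integral_add (hφ.integrable _) (hψ.integrable _)).symm)
    (fun s a φ hφ => by
      refine tendsto_nhds_unique (hΛ s _ (hφ.const_mul a)) (((hΛ s φ hφ).const_mul a).congr fun n => ?_)
      exact (integral_const_mul _ _).symm)
    (fun s φ hφ h => by
      refine ge_of_tendsto' (hΛ s φ hφ) fun n => integral_nonneg_of_ae ?_
      filter_upwards [ae_nonneg_of_null ((hu n).curve.null s)] with x hx using h x hx)
    (fun φ hφ => by
      obtain ⟨a, ha, hle⟩ := exists_le_mul_weight hw hw0 hφ
      have hlim : Tendsto (fun n : ℕ => a * (2 * D * (1 / 2 : ℝ) ^ n)) atTop (𝓝 0) := by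
        have := ((tendsto_pow_atTop_nhds_zero_of_lt_one (r := (1 / 2 : ℝ)) (by norm_num)
          (by norm_num)).const_mul (2 * D)).const_mul a
        simpa using this
      have hunif : TendstoUniformly (fun n s => ∫ x, φ x ∂(u n s)) (fun s => Λ s φ) atTop := by
        rw [Metric.tendstoUniformly_iff]
        intro ε hε
        filter_upwards [hlim.eventually (gt_mem_nhds hε)] with n hn s
        rw [dist_comm]
        exact (hclose φ hφ a ha.le hle s n).trans_lt hn
      exact hunif.continuous (.of_forall fun n => (hu n).curve.cont φ hφ))
  have hHfin := hH.fin
  refine ⟨H, ⟨hH, fun s => ?_⟩, fun n s φ hφ hle => ?_, fun s φ hφ => ?_⟩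
  · refine integrable_and_integral_le_of_tent hw (fun x => (hw0 x).le) fun n => ?_
    have ht : IsTest fun x => w x * tent n x := by
      simpa only [mul_comm] using (isTest_tent n).mul_right hw
    rw [hHΛ s _ ht]
    refine le_of_tendsto' (hΛ s _ ht) fun m => (le_abs_self _).trans
      (abs_integral_le_of_abs_le_weight ((hu m).bound s) fun x => ?_)
    rw [abs_of_nonneg (mul_nonneg (hw0 x).le (tent_nonneg n x))]
    exact mul_le_of_le_one_right (hw0 x).le (tent_le_one n x)
  · rw [hHΛ s φ hφ, ← Real.dist_eq]
    simpa using hclose φ hφ 1 zero_le_one (by simpa using hle) s n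
  · rw [hHΛ s φ hφ]
    exact hΛ s φ hφ

namespace RegKernel

variable {k : ℝ → ℝ → ℝ → ℝ} {w : ℝ → ℝ} {L c b B N T : ℝ} {H H' : ℝ → Measure ℝ}
  {h0 : Measure ℝ}

theorem isTest_weight_tent (hk : RegKernel k w L c) (n : ℕ) : IsTest fun x => w x * tent n x := by
  simpa only [mul_comm] using (isTest_tent n).mul_right hk.w_cont

theorem weight_tent_nonneg (hk : RegKernel k w L c) (n : ℕ) (x : ℝ) : 0 ≤ w x * tent n x :=
  mul_nonneg (hk.w_pos x).le (tent_nonneg n x)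

theorem weight_tent_le (hk : RegKernel k w L c) (n : ℕ) (x : ℝ) : w x * tent n x ≤ w x :=
  mul_le_of_le_one_right (hk.w_pos x).le (tent_le_one n x)

theorem integral_weight_tent_le (hk : RegKernel k w L c) [IsFiniteMeasureOnCompacts h0]
    (hN : Integrable w h0 ∧ ∫ x, w x ∂h0 ≤ N) (n : ℕ) : ∫ x, w x * tent n x ∂h0 ≤ N :=
  (integral_mono ((hk.isTest_weight_tent n).integrable _) hN.1 (hk.weight_tent_le n)).trans hN.2

theorem exists_duhamel_curve (hk : RegKernel k w L c) (hh0 : h0 (Iio 0) = 0)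
    [IsFiniteMeasureOnCompacts h0] (hb : 0 ≤ b) (hN : Integrable w h0 ∧ ∫ x, w x ∂h0 ≤ N)
    (hT : 0 ≤ T) (hTB : exp (b * T) * (N + T * (L * B * B)) ≤ B) (hH : BoundedCurve w B H) :
    ∃ H₁, BoundedCurve w B H₁ ∧
      ∀ t φ, IsTest φ → ∫ x, φ x ∂(H₁ t) = duhamel k b h0 H (clamp T t) φ := by
  have hw0 : ∀ x, 0 ≤ w x := fun x => (hk.w_pos x).le
  have hL := hk.L_nonneg
  have hB : 0 ≤ B := (integral_nonneg hw0).trans (hH.bound 0).2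
  obtain ⟨H₁, h1, h2⟩ := exists_vagueCurve (fun t φ => duhamel k b h0 H (clamp T t) φ)
    (fun t φ ψ hφ hψ => hk.duhamel_add hH.curve hφ hψ _)
    (fun t a φ _ => duhamel_const_mul a _ φ)
    (fun t φ _ h => hk.duhamel_nonneg hh0 (clamp_nonneg T t) h)
    (fun φ hφ => (hk.continuous_duhamel hH.curve hh0 hφ).comp (continuous_clamp T))
  refine ⟨H₁, ⟨h1, fun t => ?_⟩, h2⟩
  have := h1.fin
  refine integrable_and_integral_le_of_tent hk.w_cont hw0 fun n => ?_
  rw [h2 t _ (hk.isTest_weight_tent n)]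
  refine (hk.duhamel_le hH.curve hh0 hb (clamp_nonneg T t) (clamp_le hT t)
    (hk.isTest_weight_tent n) (fun x _ => hk.weight_tent_nonneg n x) (G := L * B * B)
    fun s _ _ => ?_).trans (le_trans ?_ hTB)
  · refine (le_abs_self _).trans ((hk.abs_gain_le s (hH.bound s).1 (hH.bound s).1 hw0 hw0
      fun y z _ hz => ?_).trans ?_)
    · refine mul_le_mul ?_ (hk.le s y z) (hk.nonneg s y z) (hw0 y)
      rw [abs_of_nonneg (hk.weight_tent_nonneg n _)]
      exact (hk.weight_tent_le n _).trans (hk.w_anti (by linarith))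
    · exact mul_le_mul (mul_le_mul_of_nonneg_left (hH.bound s).2 hL) (hH.bound s).2
        (integral_nonneg hw0) (by positivity)
  · have := hk.integral_weight_tent_le hN n
    have := clamp_le hT t
    gcongr

/-- Local existence for the abstract mild equation. -/
theorem exists_clampedSolution (hk : RegKernel k w L c) (hh0 : h0 (Iio 0) = 0)
    [IsFiniteMeasureOnCompacts h0] (hb : 0 ≤ b) (hN : Integrable w h0 ∧ ∫ x, w x ∂h0 ≤ N)
    (hT : 0 ≤ T) (hNB : N ≤ B) (hTB : exp (b * T) * (N + T * (L * B * B)) ≤ B)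
    (hTκ : exp (b * T) * T * (L * N + T * L ^ 2 * B ^ 2 + 2 * L * B) ≤ 1 / 2) :
    ∃ H, BoundedCurve w B H ∧ IsClampedSolution k b T h0 H := by
  have hw0 := hk.w_pos
  choose next hnext hnext' using fun (H : {H // BoundedCurve w B H}) =>
    hk.exists_duhamel_curve hh0 hb hN hT hTB H.2
  let u : ℕ → {H // BoundedCurve w B H} := fun n => (fun H => ⟨next H, hnext H⟩)^[n]
    ⟨fun _ => h0, .const hh0, fun _ => ⟨hN.1, hN.2.trans hNB⟩⟩
  have hu : ∀ n t φ, IsTest φ →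
      ∫ x, φ x ∂((u (n + 1)).1 t) = duhamel k b h0 (u n).1 (clamp T t) φ := by
    intro n t φ hφ
    have : u (n + 1) = ⟨next (u n), hnext (u n)⟩ := Function.iterate_succ_apply' _ _ _
    rw [this]
    exact hnext' (u n) t φ hφ
  have hcontr : ∀ (F F' : ℝ → Measure ℝ) (d : ℝ), BoundedCurve w B F → BoundedCurve w B F' →
      (∀ s, WDist w (F s) (F' s) d) → ∀ t φ, IsTest φ → (∀ x, |φ x| ≤ w x) →
      |duhamel k b h0 F (clamp T t) φ - duhamel k b h0 F' (clamp T t) φ| ≤ 1 / 2 * d :=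
    fun F F' d hF hF' hd t φ hφ hφw => (hk.abs_duhamel_sub_le hF.curve hF'.curve hb hF.bound
      hF'.bound hN (clamp_nonneg T t) (clamp_le hT t) hd hφ hφw).trans
      (mul_le_mul_of_nonneg_right hTκ ((hd 0).nonneg hw0))
  have hd : ∀ n s, WDist w ((u n).1 s) ((u (n + 1)).1 s) (2 * B * (1 / 2) ^ n) := by
    intro n
    induction n with
    | zero => intro s; simpa using wdist_two_mul ((u 0).2.bound s) ((u 1).2.bound s)
    | succ n ih =>
      intro s φ hφ hφw
      rw [hu n s φ hφ, hu (n + 1) s φ hφ]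
      exact (hcontr _ _ _ (u n).2 (u (n + 1)).2 ih s φ hφ hφw).trans_eq (by ring)
  obtain ⟨H, hH, hclose, hlim⟩ := exists_limit_curve hk.w_cont hw0 (fun n => (u n).2) hd
  refine ⟨H, hH, ?_⟩
  have key : ∀ t φ, IsTest φ → (∀ x, |φ x| ≤ w x) →
      ∫ x, φ x ∂(H t) = duhamel k b h0 H (clamp T t) φ := by
    intro t φ hφ hφw
    refine tendsto_nhds_unique ((hlim t φ hφ).comp (tendsto_add_atTop_nat 1)) ?_
    rw [tendsto_iff_dist_tendsto_zero]
    have hz : Tendsto (fun n : ℕ => 1 / 2 * (2 * (2 * B) * (1 / 2 : ℝ) ^ n)) atTop (𝓝 0) := by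
      have := ((tendsto_pow_atTop_nhds_zero_of_lt_one (r := (1 / 2 : ℝ)) (by norm_num)
        (by norm_num)).const_mul (2 * (2 * B))).const_mul (1 / 2)
      simpa using this
    refine squeeze_zero (fun _ => dist_nonneg) (fun n => ?_) hz
    simp only [Function.comp_apply]
    rw [hu n t φ hφ, Real.dist_eq]
    exact hcontr _ _ _ (u n).2 hH (hclose n) t φ hφ hφw
  intro t φ hφ
  obtain ⟨a, ha, hle⟩ := exists_le_mul_weight hk.w_cont hw0 hφ
  have := key t _ (hφ.const_mul a⁻¹) fun x => by
    rw [abs_mul, abs_of_pos (inv_pos.2 ha), inv_mul_le_iff₀ ha]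
    exact hle x
  rw [integral_const_mul, duhamel_const_mul] at this
  exact mul_left_cancel₀ (inv_pos.2 ha).ne' this

/-- Uniqueness for the abstract mild equation among bounded curves. -/
theorem clampedSolution_unique (hk : RegKernel k w L c)
    [IsFiniteMeasureOnCompacts h0] (hb : 0 ≤ b) (hN : Integrable w h0 ∧ ∫ x, w x ∂h0 ≤ N)
    (hT : 0 ≤ T)
    (hTκ : exp (b * T) * T * (L * N + T * L ^ 2 * B ^ 2 + 2 * L * B) ≤ 1 / 2)
    (hH : BoundedCurve w B H) (hH' : BoundedCurve w B H') (hs : IsClampedSolution k b T h0 H)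
    (hs' : IsClampedSolution k b T h0 H') (t : ℝ) : H t = H' t := by
  have hd : ∀ n : ℕ, ∀ s, WDist w (H s) (H' s) (2 * B * (1 / 2) ^ n) := by
    intro n
    induction n with
    | zero => intro s; simpa using wdist_two_mul (hH.bound s) (hH'.bound s)
    | succ n ih =>
      intro s φ hφ hφw
      rw [hs s φ hφ, hs' s φ hφ]
      refine ((hk.abs_duhamel_sub_le hH.curve hH'.curve hb hH.bound hH'.bound hN (clamp_nonneg T s)
        (clamp_le hT s) ih hφ hφw).trans
        (mul_le_mul_of_nonneg_right hTκ ((ih 0).nonneg hk.w_pos))).trans_eq (by ring)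
  have := hH.curve.fin
  have := hH'.curve.fin
  refine measure_eq_of_integral_eq fun φ hφ => ?_
  obtain ⟨a, ha, hle⟩ := exists_le_mul_weight hk.w_cont hk.w_pos hφ
  have hz : Tendsto (fun n : ℕ => a * (2 * B * (1 / 2 : ℝ) ^ n)) atTop (𝓝 0) := by
    have := ((tendsto_pow_atTop_nhds_zero_of_lt_one (r := (1 / 2 : ℝ)) (by norm_num)
      (by norm_num)).const_mul (2 * B)).const_mul a
    simpa using this
  have h0 := ge_of_tendsto' hz fun n => (hd n t).of_le_mul ha.le hφ hle
  exact sub_eq_zero.1 (abs_nonpos_iff.1 h0)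

/-- Every solution on a short time interval satisfies the a priori bound. -/
theorem boundedCurve_of_isClampedSolution (hk : RegKernel k w L c) (hh0 : h0 (Iio 0) = 0)
    [IsFiniteMeasureOnCompacts h0] (hb : 0 ≤ b) (hN : Integrable w h0 ∧ ∫ x, w x ∂h0 ≤ N)
    (hT : 0 ≤ T) (hB : 0 ≤ B) (hTB : exp (b * T) * (N + T * (L * B * B)) < B) (hH : VagueCurve H)
    (hconst : ∀ t, H t = H (clamp T t)) (hs : IsClampedSolution k b T h0 H) :
    BoundedCurve w B H := by
  have := hH.fin
  have hL := hk.L_nonneg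
  refine ⟨hH, fun t => integrable_and_integral_le_of_tent hk.w_cont (fun x => (hk.w_pos x).le)
    fun n => ?_⟩
  set g : ℝ → ℝ := fun t => ∫ x, w x * tent n x ∂(H t) with hg
  have hgc : Continuous g := hH.cont _ (hk.isTest_weight_tent n)
  have hg0 : ∀ s, 0 ≤ g s := fun s => integral_nonneg (hk.weight_tent_nonneg n)
  suffices h : ∀ s ∈ Icc 0 T, g s < B by
    rw [hconst t]
    exact (h _ (clamp_mem hT t)).le
  by_contra! hcon
  obtain ⟨t₁, ht₁, hgt₁⟩ := hcon
  have hcomp : IsCompact (Icc 0 T ∩ {s | B ≤ g s}) :=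
    isCompact_Icc.inter_right (isClosed_le continuous_const hgc)
  obtain ⟨r, ⟨hr, hgr⟩, hmin⟩ := hcomp.exists_isLeast ⟨t₁, ht₁, hgt₁⟩
  have hlt : ∀ s, 0 < s → s < r → g s ≤ B := by
    intro s hs0 hsr
    by_contra hc
    exact absurd (hmin ⟨⟨hs0.le, hsr.le.trans hr.2⟩, (not_le.1 hc).le⟩) (not_le.2 hsr)
  have hgr' : g r = duhamel k b h0 H r fun x => w x * tent n x := by
    rw [hg]; simp only
    rw [hs r _ (hk.isTest_weight_tent n), clamp_of_mem hr]
  have hle := hk.duhamel_le hH hh0 hb hr.1 hr.2 (hk.isTest_weight_tent n)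
    (fun x _ => hk.weight_tent_nonneg n x) (G := L * B * B) fun s hs0 hsr => by
    refine (le_abs_self _).trans ((hk.abs_gain_le s ((hk.isTest_weight_tent n).integrable (H s))
      ((hk.isTest_weight_tent n).integrable (H s)) (hk.weight_tent_nonneg n)
      (hk.weight_tent_nonneg n) fun y z hy hz => ?_).trans ?_)
    · rw [abs_of_nonneg (hk.weight_tent_nonneg n _)]
      have h1 := tent_add_le n hy.le hz.le
      have h2 : w (y + z) ≤ w y := hk.w_anti (by linarith)
      calc w (y + z) * tent n (y + z) * k s y z
          ≤ w y * (tent n y * tent n z) * (L * w z) :=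
            mul_le_mul (mul_le_mul h2 h1 (tent_nonneg _ _) (hk.w_pos y).le) (hk.le s y z)
              (hk.nonneg _ _ _) (mul_nonneg (hk.w_pos y).le
                (mul_nonneg (tent_nonneg _ _) (tent_nonneg _ _)))
        _ = w y * tent n y * (L * (w z * tent n z)) := by ring
    · have h := hlt s hs0 hsr
      exact mul_le_mul (mul_le_mul_of_nonneg_left h hL) h (hg0 s) (by positivity)
  rw [← hgr'] at hle
  have h1 := hk.integral_weight_tent_le hN n
  have h2 : exp (b * T) * (∫ x, w x * tent n x ∂h0 + r * (L * B * B)) ≤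
      exp (b * T) * (N + T * (L * B * B)) := by
    have := hr.2
    gcongr
  have : B ≤ g r := hgr
  linarith

theorem integral_le_two_mul (hk : RegKernel k w L c) (hh0 : h0 (Iio 0) = 0)
    [IsFiniteMeasureOnCompacts h0] (hb : 0 ≤ b) (hH : BoundedCurve w B H)
    (hs : IsClampedSolution k b T h0 H) (hT1 : exp (b * T) ≤ 3 / 2)
    (hT2 : exp (b * T) * (T * (L * B)) ≤ 1 / 4) {φ : ℝ → ℝ} (hφ : IsTest φ) (hφ0 : ∀ x, 0 ≤ φ x)
    (hφa : AntitoneOn φ (Ici 0)) (t : ℝ) (ht : t ∈ Icc 0 T) :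
    ∫ x, φ x ∂(H t) ≤ 2 * ∫ x, φ x ∂h0 := by
  have := hH.curve.fin
  have hL := hk.L_nonneg
  have hw0 : ∀ x, 0 ≤ w x := fun x => (hk.w_pos x).le
  have hB : 0 ≤ B := (integral_nonneg hw0).trans (hH.bound 0).2
  obtain ⟨r, hr, hmax⟩ := (isCompact_Icc (a := 0) (b := T)).exists_isMaxOn ⟨t, ht⟩
    (hH.curve.cont φ hφ).continuousOn
  set G := ∫ x, φ x ∂(H r) with hG
  have hG0 : 0 ≤ G := integral_nonneg hφ0
  have hle := hk.duhamel_le hH.curve hh0 hb hr.1 hr.2 hφ (fun x _ => hφ0 x) (G := L * G * B)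
    fun s hs0 hsr => by
    refine (le_abs_self _).trans ((hk.abs_gain_le s (hφ.integrable (H s)) (hH.bound s).1 hφ0 hw0
      fun y z hy hz => ?_).trans ?_)
    · rw [abs_of_nonneg (hφ0 _)]
      exact mul_le_mul (hφa hy.le (add_pos hy hz).le (by linarith)) (hk.le s y z)
        (hk.nonneg _ _ _) (hφ0 y)
    · have h : ∫ x, φ x ∂(H s) ≤ G := hmax ⟨hs0.le, hsr.le.trans hr.2⟩
      exact mul_le_mul (mul_le_mul_of_nonneg_left h hL) (hH.bound s).2 (integral_nonneg hw0)
        (by positivity)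
  have hGe : G = duhamel k b h0 H r φ := by rw [hG, hs r φ hφ, clamp_of_mem hr]
  rw [← hGe] at hle
  have hi : 0 ≤ ∫ x, φ x ∂h0 := integral_nonneg hφ0
  have h1 : exp (b * T) * (r * (L * G * B)) ≤ 1 / 4 * G := by
    calc exp (b * T) * (r * (L * G * B)) ≤ exp (b * T) * (T * (L * G * B)) := by
          have := hr.2
          gcongr
      _ = exp (b * T) * (T * (L * B)) * G := by ring
      _ ≤ 1 / 4 * G := mul_le_mul_of_nonneg_right hT2 hG0
  have h2 := mul_le_mul_of_nonneg_right hT1 hi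
  have h3 : ∫ x, φ x ∂(H t) ≤ G := hmax ht
  linarith

/-- The mass of the solution on an interval at most doubles. -/
theorem measure_Icc_le (hk : RegKernel k w L c) (hh0 : h0 (Iio 0) = 0)
    [IsFiniteMeasureOnCompacts h0] (hb : 0 ≤ b) (hH : BoundedCurve w B H)
    (hs : IsClampedSolution k b T h0 H) (hT1 : exp (b * T) ≤ 3 / 2)
    (hT2 : exp (b * T) * (T * (L * B)) ≤ 1 / 4) {R ε : ℝ} (hε : 0 < ε) {t : ℝ}
    (ht : t ∈ Icc 0 T) : H t (Icc 0 R) ≤ 2 * h0 (Icc 0 (R + ε)) := by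
  have := hH.curve.fin
  obtain ⟨χ, hχ, hχ0, hχ1, hχR, hχz, hχa⟩ := exists_plateau R hε
  have h := hk.integral_le_two_mul hh0 hb hH hs hT1 hT2 hχ hχ0 hχa t ht
  have h1 : H t (Icc 0 R) ≤ ENNReal.ofReal (∫ x, χ x ∂(H t)) := by
    rw [ofReal_integral_eq_lintegral_ofReal (hχ.integrable _) (ae_of_all _ hχ0),
      ← lintegral_indicator_one measurableSet_Icc]
    refine lintegral_mono fun x => ?_
    by_cases hx : x ∈ Icc 0 R
    · rw [indicator_of_mem hx, hχR x (by rw [abs_of_nonneg hx.1]; exact hx.2)]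
      simp
    · rw [indicator_of_notMem hx]
      exact zero_le
  have h2 : ENNReal.ofReal (∫ x, χ x ∂h0) ≤ h0 (Icc 0 (R + ε)) := by
    rw [ofReal_integral_eq_lintegral_ofReal (hχ.integrable _) (ae_of_all _ hχ0),
      ← lintegral_indicator_one measurableSet_Icc]
    refine lintegral_mono_ae ?_
    filter_upwards [ae_nonneg_of_null hh0] with x hx
    by_cases hx' : x ∈ Icc 0 (R + ε)
    · rw [indicator_of_mem hx', Pi.one_apply, ENNReal.ofReal_le_one]
      exact hχ1 x
    · rw [hχz x (by rw [abs_of_nonneg hx]; exact not_le.1 fun hc => hx' ⟨hx, hc⟩)]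
      simp
  calc H t (Icc 0 R) ≤ ENNReal.ofReal (2 * ∫ x, χ x ∂h0) :=
        h1.trans (ENNReal.ofReal_le_ofReal h)
    _ = 2 * ENNReal.ofReal (∫ x, χ x ∂h0) := by
        rw [ENNReal.ofReal_mul zero_le_two, ENNReal.ofReal_ofNat]
    _ ≤ _ := by gcongr

end RegKernel

theorem CutoffHyp.continuous {ζ : ℝ → ℝ} (h : CutoffHyp ζ) : Continuous ζ := by
  refine continuous_iff_continuousAt.2 fun x => ?_
  rcases lt_or_ge x (1 / 2) with hx | hx
  · have : ζ =ᶠ[𝓝 x] fun _ => 0 := by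
      filter_upwards [gt_mem_nhds hx] with y hy using h.zero y hy.le
    exact continuousAt_const.congr this.symm
  · exact h.smooth.continuousOn.continuousAt (Ici_mem_nhds (by linarith))

theorem CutoffHyp.nonneg {ζ : ℝ → ℝ} (h : CutoffHyp ζ) (s : ℝ) : 0 ≤ ζ s := by
  rcases le_total s (1 / 2) with hs | hs
  · rw [h.zero s hs]
  · rw [← h.zero 0 (by norm_num)]
    exact h.mono (mem_Ici.2 le_rfl) (mem_Ici.2 (by linarith)) (by linarith)

theorem CutoffHyp.le_one {ζ : ℝ → ℝ} (h : CutoffHyp ζ) (s : ℝ) : ζ s ≤ 1 := by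
  rcases le_total s 1 with hs | hs
  · rcases le_total s 0 with hs0 | hs0
    · rw [h.zero s (by linarith)]
      exact zero_le_one
    · rw [← h.one 1 le_rfl]
      exact h.mono hs0 (mem_Ici.2 zero_le_one) hs
  · rw [h.one s hs]

theorem CutoffHyp.lt_of_ne_zero {ζ : ℝ → ℝ} (h : CutoffHyp ζ) {s : ℝ} (hs : ζ s ≠ 0) :
    1 / 2 < s := by
  by_contra hc
  exact hs (h.zero s (not_lt.1 hc))

section Kernel

variable {K : ℝ → ℝ → ℝ} {ζ : ℝ → ℝ} {γ C lam β : ℝ}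

theorem Kreg_eq_zero (hζ : CutoffHyp ζ) (hlam : 0 < lam) {y z : ℝ}
    (h : y < lam / 2 ∨ z < lam / 2) : Kreg K ζ lam y z = 0 := by
  unfold Kreg
  rcases h with h | h
  · rw [hζ.zero (y / lam) (by rw [div_le_iff₀ hlam]; linarith)]
    ring
  · rw [hζ.zero (z / lam) (by rw [div_le_iff₀ hlam]; linarith)]
    ring

theorem Kreg_supp (hζ : CutoffHyp ζ) (hlam : 0 < lam) {y z : ℝ} (h : Kreg K ζ lam y z ≠ 0) :
    lam / 2 ≤ y ∧ lam / 2 ≤ z ∧ y ≤ 2 / lam * z ∧ z ≤ 2 / lam * y := by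
  have hy : lam / 2 ≤ y := not_lt.1 fun hc => h (Kreg_eq_zero hζ hlam (.inl hc))
  have hz : lam / 2 ≤ z := not_lt.1 fun hc => h (Kreg_eq_zero hζ hlam (.inr hc))
  have hy0 : 0 < y := by linarith
  have hz0 : 0 < z := by linarith
  unfold Kreg at h
  have h1 := hζ.lt_of_ne_zero (right_ne_zero_of_mul h)
  have h2 := hζ.lt_of_ne_zero (right_ne_zero_of_mul (left_ne_zero_of_mul h))
  rw [lt_div_iff₀ (by positivity)] at h1 h2
  refine ⟨hy, hz, ?_, ?_⟩
  · rw [div_mul_eq_mul_div, le_div_iff₀ hlam]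
    nlinarith
  · rw [div_mul_eq_mul_div, le_div_iff₀ hlam]
    nlinarith

theorem Kreg_nonneg (hK : KernelHyp K γ C) (hζ : CutoffHyp ζ) (hlam : 0 < lam) (y z : ℝ) :
    0 ≤ Kreg K ζ lam y z := by
  by_cases h : Kreg K ζ lam y z = 0
  · rw [h]
  obtain ⟨h1, h2, -⟩ := Kreg_supp hζ hlam h
  have := hK.nonneg y z (by linarith) (by linarith)
  unfold Kreg
  have := hζ.nonneg
  exact mul_nonneg (mul_nonneg (mul_nonneg (mul_nonneg ‹_› (this _)) (this _)) (this _)) (this _)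

theorem Kreg_le (hK : KernelHyp K γ C) (hζ : CutoffHyp ζ) (hγ : 0 ≤ γ) (hC : 0 < C)
    (hlam : 0 < lam) {y z : ℝ} (h : Kreg K ζ lam y z ≠ 0) :
    Kreg K ζ lam y z ≤ C * ((2 / lam) ^ γ + 1) * z ^ γ := by
  obtain ⟨h1, h2, h3, -⟩ := Kreg_supp hζ hlam h
  have hy0 : 0 < y := by linarith
  have hz0 : 0 < z := by linarith
  have hle : Kreg K ζ lam y z ≤ K y z := by
    unfold Kreg
    have h0 := hζ.nonneg
    have h1 := hζ.le_one
    have hK0 := hK.nonneg y z hy0 hz0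
    refine (mul_le_of_le_one_right ?_ (h1 _)).trans ((mul_le_of_le_one_right ?_ (h1 _)).trans
      ((mul_le_of_le_one_right ?_ (h1 _)).trans (mul_le_of_le_one_right hK0 (h1 _))))
    · exact mul_nonneg (mul_nonneg (mul_nonneg hK0 (h0 _)) (h0 _)) (h0 _)
    · exact mul_nonneg (mul_nonneg hK0 (h0 _)) (h0 _)
    · exact mul_nonneg hK0 (h0 _)
  have hyz : y ^ γ ≤ (2 / lam) ^ γ * z ^ γ := by
    rw [← mul_rpow (by positivity) hz0.le]
    exact rpow_le_rpow hy0.le h3 hγ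
  calc Kreg K ζ lam y z ≤ C * (y ^ γ + z ^ γ) := hle.trans (hK.growth y z hy0 hz0)
    _ ≤ C * ((2 / lam) ^ γ * z ^ γ + z ^ γ) := by gcongr
    _ = _ := by ring

theorem continuous_Kreg (hK : KernelHyp K γ C) (hζ : CutoffHyp ζ) (hlam : 0 < lam) :
    Continuous fun p : ℝ × ℝ => Kreg K ζ lam p.1 p.2 := by
  refine continuous_iff_continuousAt.2 fun p => ?_
  by_cases hp : p.1 < lam / 2 ∨ p.2 < lam / 2
  · have : (fun p : ℝ × ℝ => Kreg K ζ lam p.1 p.2) =ᶠ[𝓝 p] fun _ => 0 := by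
      have ho : IsOpen {p : ℝ × ℝ | p.1 < lam / 2 ∨ p.2 < lam / 2} :=
        (isOpen_lt continuous_fst continuous_const).union
          (isOpen_lt continuous_snd continuous_const)
      filter_upwards [ho.mem_nhds hp] with q hq using Kreg_eq_zero hζ hlam hq
    exact continuousAt_const.congr this.symm
  · push Not at hp
    have h1 : 0 < p.1 := by linarith
    have h2 : 0 < p.2 := by linarith
    have hKc : ContinuousAt (fun p : ℝ × ℝ => K p.1 p.2) p :=
      hK.cont.continuousAt (prod_mem_nhds (Ioi_mem_nhds h1) (Ioi_mem_nhds h2))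
    have hne : lam * (p.1 + p.2) ≠ 0 := by positivity
    have hζc := hζ.continuous
    have hd : ContinuousAt (fun p : ℝ × ℝ => lam * (p.1 + p.2)) p := by fun_prop
    unfold Kreg
    refine (((hKc.mul ?_).mul ?_).mul ?_).mul ?_
    · exact hζc.continuousAt.comp (f := fun p : ℝ × ℝ => p.1 / lam)
        (continuousAt_fst.div_const _)
    · exact hζc.continuousAt.comp (f := fun p : ℝ × ℝ => p.2 / lam)
        (continuousAt_snd.div_const _)
    · exact hζc.continuousAt.comp (f := fun p : ℝ × ℝ => p.1 / (lam * (p.1 + p.2)))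
        (continuousAt_fst.div hd hne)
    · exact hζc.continuousAt.comp (f := fun p : ℝ × ℝ => p.2 / (lam * (p.1 + p.2)))
        (continuousAt_snd.div hd hne)

/-- The rate density of the regularized problem, frozen for negative times. -/
def rateDensity (Kl : ℝ → ℝ → ℝ) (β s y z : ℝ) : ℝ :=
  Kl (y * exp (-(β * max s 0))) (z * exp (-(β * max s 0))) / z

/-- The weight for which the rate density is bounded. -/
def weight (γ x : ℝ) : ℝ := (1 + max x 0) ^ (γ - 1)

theorem weight_base_pos (x : ℝ) : 0 < 1 + max x 0 := by
  have := le_max_right x 0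
  linarith

theorem weight_pos (γ x : ℝ) : 0 < weight γ x := rpow_pos_of_pos (weight_base_pos x) _

theorem continuous_weight (γ : ℝ) : Continuous (weight γ) := by
  unfold weight
  exact (by fun_prop : Continuous fun x : ℝ => 1 + max x 0).rpow_const
    fun x => .inl (weight_base_pos x).ne'

theorem antitone_weight (hγ : γ < 1) : Antitone (weight γ) := fun x y hxy =>
  rpow_le_rpow_of_nonpos (weight_base_pos x) (by gcongr) (by linarith)

theorem regKernel_rateDensity (hK : KernelHyp K γ C) (hζ : CutoffHyp ζ) (hγ : γ ∈ Ico (0 : ℝ) 1)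
    (hC : 0 < C) (hlam : 0 < lam) (hβ : 0 ≤ β) :
    RegKernel (rateDensity (Kreg K ζ lam) β) (weight γ)
      (C * ((2 / lam) ^ γ + 1) * (1 + 2 / lam) ^ (1 - γ)) (2 / lam) where
  cont := by
    have hcK := continuous_Kreg hK hζ hlam
    have hcz : Continuous fun p : ℝ × ℝ × ℝ => p.2.2 * exp (-(β * max p.1 0)) := by fun_prop
    have hcy : Continuous fun p : ℝ × ℝ × ℝ => p.2.1 * exp (-(β * max p.1 0)) := by fun_prop
    refine continuous_iff_continuousAt.2 fun p => ?_
    by_cases hp : p.2.2 * exp (-(β * max p.1 0)) < lam / 2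
    · have : (fun p : ℝ × ℝ × ℝ => rateDensity (Kreg K ζ lam) β p.1 p.2.1 p.2.2) =ᶠ[𝓝 p]
          fun _ => 0 := by
        filter_upwards [(isOpen_lt hcz continuous_const).mem_nhds hp] with q hq
        rw [rateDensity, Kreg_eq_zero hζ hlam (.inr hq), zero_div]
      exact continuousAt_const.congr this.symm
    · have hne : p.2.2 ≠ 0 := by
        rintro h0
        rw [h0, zero_mul] at hp
        linarith
      exact (hcK.comp (hcy.prodMk hcz)).continuousAt.div (by fun_prop) hne
  nonneg s y z := by
    unfold rateDensity
    by_cases h : Kreg K ζ lam (y * exp (-(β * max s 0))) (z * exp (-(β * max s 0))) = 0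
    · rw [h, zero_div]
    · have h2 := (Kreg_supp hζ hlam h).2.1
      have : 0 < z := pos_of_mul_pos_left (lt_of_lt_of_le (by linarith) h2) (exp_pos _).le
      exact div_nonneg (Kreg_nonneg hK hζ hlam _ _) this.le
  supp s y z h := by
    have h' : Kreg K ζ lam (y * exp (-(β * max s 0))) (z * exp (-(β * max s 0))) ≠ 0 := by
      rintro h0
      rw [rateDensity, h0, zero_div] at h
      exact h rfl
    obtain ⟨h1, h2, -, h4⟩ := Kreg_supp hζ hlam h'
    refine ⟨pos_of_mul_pos_left (lt_of_lt_of_le (by linarith) h1) (exp_pos _).le,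
      pos_of_mul_pos_left (lt_of_lt_of_le (by linarith) h2) (exp_pos _).le, ?_⟩
    rw [← mul_assoc] at h4
    exact le_of_mul_le_mul_right h4 (exp_pos _)
  le s y z := by
    have hw := (weight_pos γ z).le
    unfold rateDensity
    by_cases h : Kreg K ζ lam (y * exp (-(β * max s 0))) (z * exp (-(β * max s 0))) = 0
    · rw [h, zero_div]
      positivity
    have h1 := (Kreg_supp hζ hlam h).2.1
    have hle := Kreg_le hK hζ hγ.1 hC hlam h
    set e := exp (-(β * max s 0)) with he
    have he0 : 0 < e := exp_pos _
    have he1 : e ≤ 1 := by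
      rw [he, exp_le_one_iff]
      have := mul_nonneg hβ (le_max_right s 0)
      linarith
    have hze : 0 < z * e := by linarith
    have hz : 0 < z := pos_of_mul_pos_left hze he0.le
    have hzz : z * e ≤ z := mul_le_of_le_one_right hz.le he1
    have hz2 : z ^ (γ - 1) ≤ (1 + 2 / lam) ^ (1 - γ) * weight γ z := by
      have hb : (0 : ℝ) < 1 + 2 / lam := by positivity
      have hle' : (1 + z) / (1 + 2 / lam) ≤ z := by
        rw [div_le_iff₀ hb]
        have : 1 ≤ z * (2 / lam) := by
          rw [mul_div_assoc', le_div_iff₀ hlam]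
          linarith
        linarith
      have := rpow_le_rpow_of_nonpos (z := γ - 1) (by positivity) hle' (by linarith [hγ.2])
      rw [div_rpow (by positivity) hb.le] at this
      rw [weight, max_eq_left hz.le, show 1 - γ = -(γ - 1) by ring, rpow_neg hb.le,
        inv_mul_eq_div]
      exact this
    rw [div_le_iff₀ hz]
    calc _ ≤ C * ((2 / lam) ^ γ + 1) * (z * e) ^ γ := hle
      _ ≤ C * ((2 / lam) ^ γ + 1) * z ^ γ := by
        have := rpow_le_rpow hze.le hzz hγ.1
        gcongr
      _ = C * ((2 / lam) ^ γ + 1) * (z ^ (γ - 1) * z) := by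
        rw [← rpow_add_one hz.ne', sub_add_cancel]
      _ ≤ C * ((2 / lam) ^ γ + 1) * ((1 + 2 / lam) ^ (1 - γ) * weight γ z * z) := by
        gcongr
      _ = _ := by ring
  L_nonneg := by positivity
  w_cont := continuous_weight γ
  w_pos := weight_pos γ
  w_anti := antitone_weight hγ.2

end Kernel

theorem MemX.isFiniteMeasureOnCompacts {ρ : ℝ} {μ : Measure ℝ} (h : MemX ρ μ) :
    IsFiniteMeasureOnCompacts μ := by
  obtain ⟨h0, M, hM⟩ := h
  refine ⟨fun s hs => ?_⟩
  obtain ⟨R, hR, hsub⟩ := hs.isBounded.exists_pos_norm_le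
  have hcov : s ⊆ Iio 0 ∪ Icc 0 R := fun x hx => by
    rcases lt_or_ge x 0 with hx0 | hx0
    · exact .inl hx0
    · exact .inr ⟨hx0, (le_abs_self x).trans (hsub x hx)⟩
  calc μ s ≤ μ (Iio 0) + μ (Icc 0 R) := (measure_mono hcov).trans (measure_union_le _ _)
    _ ≤ 0 + ENNReal.ofReal (M * R ^ (1 - ρ)) := add_le_add h0.le (hM R hR)
    _ < ⊤ := by simp

theorem weight_le_pow {γ x : ℝ} (hγ : γ < 1) (j : ℕ) (hx : (2 : ℝ) ^ j ≤ x) :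
    weight γ x ≤ ((2 : ℝ) ^ (γ - 1)) ^ j := by
  rw [Real.rpow_pow_comm zero_le_two]
  refine rpow_le_rpow_of_nonpos (by positivity) ?_ (by linarith)
  have := le_max_left x 0
  linarith

theorem weight_le_one {γ : ℝ} (hγ : γ < 1) (x : ℝ) : weight γ x ≤ 1 := by
  refine rpow_le_one_of_one_le_of_nonpos ?_ (by linarith)
  have := le_max_right x 0
  linarith

theorem MemX.integrable_weight {ρ γ : ℝ} {μ : Measure ℝ} (h : MemX ρ μ) (hρ : ρ ∈ Ioo γ 1) :
    Integrable (weight γ) μ := by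
  obtain ⟨h0, M, hM⟩ := h
  have hγ : γ < 1 := hρ.1.trans hρ.2
  refine ⟨(continuous_weight γ).aestronglyMeasurable, ?_⟩
  rw [hasFiniteIntegral_iff_ofReal (ae_of_all _ fun x => (weight_pos γ x).le)]
  let a : ℕ → ℝ := fun j => ((2 : ℝ) ^ (γ - 1)) ^ j
  have hpt : ∀ x, 0 ≤ x → ENNReal.ofReal (weight γ x) ≤
      ∑' j, (Icc (0 : ℝ) (2 ^ (j + 1))).indicator (fun _ => ENNReal.ofReal (a j)) x := by
    intro x hx
    obtain ⟨j, hj, hxj⟩ : ∃ j : ℕ, weight γ x ≤ a j ∧ x ≤ 2 ^ (j + 1) := by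
      rcases le_total 1 x with hx1 | hx1
      · obtain ⟨j, hj, hj'⟩ := exists_nat_pow_near hx1 one_lt_two
        exact ⟨j, weight_le_pow hγ j hj, hj'.le⟩
      · exact ⟨0, by simpa [a] using weight_le_one hγ x, by norm_num; linarith⟩
    have hmem : x ∈ Icc (0 : ℝ) (2 ^ (j + 1)) := ⟨hx, hxj⟩
    calc ENNReal.ofReal (weight γ x)
        ≤ (Icc (0 : ℝ) (2 ^ (j + 1))).indicator (fun _ => ENNReal.ofReal (a j)) x := by
          rw [indicator_of_mem hmem]
          exact ENNReal.ofReal_le_ofReal hj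
      _ ≤ _ := ENNReal.le_tsum j
  have hterm : ∀ j, a j * (M * (2 ^ (j + 1)) ^ (1 - ρ)) =
      M * 2 ^ (1 - ρ) * ((2 : ℝ) ^ (γ - ρ)) ^ j := by
    intro j
    rw [← Real.rpow_pow_comm zero_le_two, pow_succ, show γ - ρ = (γ - 1) + (1 - ρ) by ring,
      rpow_add two_pos, mul_pow]
    ring
  have hsum : Summable fun j : ℕ => M * 2 ^ (1 - ρ) * ((2 : ℝ) ^ (γ - ρ)) ^ j :=
    (summable_geometric_of_lt_one (by positivity)
      (rpow_lt_one_of_one_lt_of_neg one_lt_two (by linarith [hρ.1]))).mul_left _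
  calc ∫⁻ x, ENNReal.ofReal (weight γ x) ∂μ
      ≤ ∫⁻ x, ∑' j, (Icc (0 : ℝ) (2 ^ (j + 1))).indicator (fun _ => ENNReal.ofReal (a j)) x ∂μ :=
        lintegral_mono_ae ((ae_nonneg_of_null h0).mono hpt)
    _ = ∑' j, ENNReal.ofReal (a j) * μ (Icc 0 (2 ^ (j + 1))) := by
        rw [lintegral_tsum fun j => (measurable_const.indicator measurableSet_Icc).aemeasurable]
        simp only [lintegral_indicator_const measurableSet_Icc]
    _ ≤ ∑' j, ENNReal.ofReal (M * 2 ^ (1 - ρ) * ((2 : ℝ) ^ (γ - ρ)) ^ j) := by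
        refine ENNReal.tsum_le_tsum fun j => ?_
        rw [← hterm, ENNReal.ofReal_mul (by positivity)]
        gcongr
        exact hM _ (by positivity)
    _ < ⊤ := hsum.tsum_ofReal_lt_top

theorem Acal_eq_rate {Kl : ℝ → ℝ → ℝ} {β ρ s : ℝ} (hs : 0 ≤ s) (H : ℝ → Measure ℝ) (x : ℝ) :
    Acal Kl β ρ H x s = rate (rateDensity Kl β) H s x - β * ρ := by
  simp only [Acal, rate, rateDensity, max_eq_left hs]

theorem integral_Qcal {Kl : ℝ → ℝ → ℝ} {w : ℝ → ℝ} {β L c s : ℝ}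
    (hk : RegKernel (rateDensity Kl β) w L c) (hs : 0 ≤ s) {H : ℝ → Measure ℝ}
    [IsFiniteMeasureOnCompacts (H s)] {f : ℝ → ℝ} (hf : IsTest f) :
    ∫ x, f x ∂(Qcal Kl β H s) = gain (rateDensity Kl β) s (H s) (H s) f := by
  have he : ∀ p : ℝ × ℝ, Kl (p.1 * exp (-(β * s))) (p.2 * exp (-(β * s))) / p.2 =
      rateDensity Kl β s p.1 p.2 := fun p => by rw [rateDensity, max_eq_left hs]
  have hc : Continuous fun p : ℝ × ℝ => rateDensity Kl β s p.1 p.2 :=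
    hk.cont.comp (by fun_prop : Continuous fun p : ℝ × ℝ => (s, p.1, p.2))
  have hint : Integrable (fun p : ℝ × ℝ => f (p.1 + p.2) * rateDensity Kl β s p.1 p.2)
      ((H s).prod (H s)) := by
    obtain ⟨R, -, hR⟩ := hf.exists_bound
    refine Continuous.integrable_of_hasCompactSupport
      ((hf.cont.comp (continuous_fst.add continuous_snd)).mul hc) ?_
    refine HasCompactSupport.intro ((isCompact_Icc (a := -R) (b := R)).prod
      (isCompact_Icc (a := -R) (b := R))) fun p hp => hk.gain_integrand_eq_zero hR ?_
    by_contra! hcon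
    exact hp ⟨abs_le.1 hcon.1, abs_le.1 hcon.2⟩
  simp only [Qcal, he]
  rw [integral_map (by fun_prop) hf.cont.aestronglyMeasurable,
    integral_withDensity_eq_integral_toReal_smul hc.measurable.ennreal_ofReal
      (ae_of_all _ fun _ => ENNReal.ofReal_lt_top), gain, ← integral_prod _ hint]
  refine integral_congr_ae (ae_of_all _ fun p => ?_)
  simp only [smul_eq_mul]
  rw [ENNReal.toReal_ofReal (hk.nonneg _ _ _), mul_comm]

/-- The right-hand side of the mild formulation agrees with the abstract one. -/
theorem mild_eq_duhamel {Kl : ℝ → ℝ → ℝ} {w : ℝ → ℝ} {β ρ L c T t : ℝ}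
    (hk : RegKernel (rateDensity Kl β) w L c) {h0 : Measure ℝ} {H F : ℝ → Measure ℝ}
    (hF : VagueCurve F) (hHF : ∀ s ∈ Icc 0 T, F s = H s) (ht : t ∈ Icc 0 T) {φ : ℝ → ℝ}
    (hφ : IsTest φ) :
    (∫ X, φ X * exp (-(∫ s in (0:ℝ)..t, Acal Kl β ρ H X s)) ∂h0)
      + ∫ s in (0:ℝ)..t, ∫ X, φ X * exp (-(∫ ξ in s..t, Acal Kl β ρ H X ξ)) ∂(Qcal Kl β H s) =
    duhamel (rateDensity Kl β) (β * ρ) h0 F t φ := by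
  have hdamp : ∀ s ∈ Icc 0 t, ∀ x, exp (-(∫ ξ in s..t, Acal Kl β ρ H x ξ)) =
      damp (rateDensity Kl β) (β * ρ) F s t x := by
    intro s hs x
    rw [damp]
    congr 2
    refine intervalIntegral.integral_congr fun ξ hξ => ?_
    rw [uIcc_of_le hs.2] at hξ
    have hξ0 : 0 ≤ ξ := hs.1.trans hξ.1
    simp only [Acal_eq_rate hξ0, rate, hHF ξ ⟨hξ0, hξ.2.trans ht.2⟩]
  rw [duhamel]
  congr 1
  · simp only [hdamp 0 ⟨le_rfl, ht.1⟩]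
  · refine intervalIntegral.integral_congr fun s hs => ?_
    rw [uIcc_of_le ht.1] at hs
    have hsF := hHF s ⟨hs.1, hs.2.trans ht.2⟩
    have hfin : IsFiniteMeasureOnCompacts (H s) := hsF ▸ hF.fin s
    simp only [hdamp s hs, hsF]
    exact integral_Qcal hk hs.1 (hk.isTest_mul_damp hF hφ s t)

/-- Doubling the mass on intervals at most doubles every admissible constant in `𝒳_ρ`. -/
theorem measure_Icc_le_two_mul {μ ν : Measure ℝ} {ρ M : ℝ} (hρ : ρ < 1)
    (hle : ∀ R ε : ℝ, 0 < ε → ν (Icc 0 R) ≤ 2 * μ (Icc 0 (R + ε)))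
    (hM : ∀ R > (0 : ℝ), μ (Icc 0 R) ≤ ENNReal.ofReal (M * R ^ (1 - ρ))) {R : ℝ} (hR : 0 < R) :
    ν (Icc 0 R) ≤ ENNReal.ofReal (2 * M * R ^ (1 - ρ)) := by
  have hlim : Tendsto (fun ε : ℝ => ENNReal.ofReal (2 * M * (R + ε) ^ (1 - ρ))) (𝓝[>] 0)
      (𝓝 (ENNReal.ofReal (2 * M * R ^ (1 - ρ)))) := by
    have hc : Continuous fun ε : ℝ => 2 * M * (R + ε) ^ (1 - ρ) :=
      continuous_const.mul ((continuous_const.add continuous_id).rpow_const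
        fun _ => .inr (by linarith))
    have := (ENNReal.continuous_ofReal.comp hc).tendsto 0
    simp only [Function.comp_def, add_zero] at this
    exact this.mono_left nhdsWithin_le_nhds
  refine ge_of_tendsto hlim ?_
  filter_upwards [self_mem_nhdsWithin] with ε hε
  have hε : 0 < ε := hε
  calc ν (Icc 0 R) ≤ 2 * μ (Icc 0 (R + ε)) := hle R ε hε
    _ ≤ 2 * ENNReal.ofReal (M * (R + ε) ^ (1 - ρ)) := by gcongr; exact hM _ (by linarith)
    _ = ENNReal.ofReal (2 * M * (R + ε) ^ (1 - ρ)) := by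
      rw [mul_assoc, ENNReal.ofReal_mul zero_le_two, ENNReal.ofReal_ofNat]

theorem Xnorm_le_two_mul {μ ν : Measure ℝ} {ρ : ℝ} (hρ : ρ < 1) (hμ : MemX ρ μ)
    (hle : ∀ R ε : ℝ, 0 < ε → ν (Icc 0 R) ≤ 2 * μ (Icc 0 (R + ε))) :
    Xnorm ρ ν ≤ 2 * Xnorm ρ μ := by
  rw [← div_le_iff₀' two_pos]
  obtain ⟨-, M, hM⟩ := hμ
  refine le_csInf ⟨max M 0, le_max_right _ _, fun R hR => (hM R hR).trans ?_⟩ ?_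
  · gcongr
    exact le_max_left _ _
  · rintro M' ⟨hM0, hM'⟩
    rw [div_le_iff₀' two_pos]
    exact csInf_le ⟨0, fun _ h => h.1⟩
      ⟨by positivity, fun R hR => measure_Icc_le_two_mul hρ hle hM' hR⟩

theorem exists_short_time (b N L : ℝ) {B : ℝ} (hB : N < B) : ∃ T > (0 : ℝ),
    exp (b * T) * (N + T * (L * B * B)) < B ∧
    exp (b * T) * T * (L * N + T * L ^ 2 * B ^ 2 + 2 * L * B) ≤ 1 / 2 ∧
    exp (b * T) ≤ 3 / 2 ∧ exp (b * T) * (T * (L * B)) ≤ 1 / 4 := by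
  have key : ∀ (f : ℝ → ℝ) (a : ℝ), Continuous f → f 0 < a → ∀ᶠ T in 𝓝[>] 0, f T < a :=
    fun f a hf h => nhdsWithin_le_nhds (hf.continuousAt.eventually (gt_mem_nhds h))
  have h := (key (fun T => exp (b * T) * (N + T * (L * B * B))) B (by fun_prop) (by simpa)).and
    ((key (fun T => exp (b * T) * T * (L * N + T * L ^ 2 * B ^ 2 + 2 * L * B)) (1 / 2)
      (by fun_prop) (by simp)).and
    ((key (fun T => exp (b * T)) (3 / 2) (by fun_prop) (by norm_num)).and
    ((key (fun T => exp (b * T) * (T * (L * B))) (1 / 4) (by fun_prop) (by simp)).and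
      self_mem_nhdsWithin)))
  obtain ⟨T, h1, h2, h3, h4, h5⟩ := h.exists
  exact ⟨T, h5, h1, h2.le, h3.le, h4.le⟩

/-- A mild solution, extended by constants, solves the abstract mild equation. -/
theorem IsMildSolution.isClampedSolution {Kl : ℝ → ℝ → ℝ} {w : ℝ → ℝ} {β ρ L c T : ℝ}
    {h0 : Measure ℝ} {H : ℝ → Measure ℝ} (hk : RegKernel (rateDensity Kl β) w L c) (hT : 0 ≤ T)
    (h : IsMildSolution Kl β ρ T h0 H) :
    VagueCurve (fun t => H (clamp T t)) ∧
      IsClampedSolution (rateDensity Kl β) (β * ρ) T h0 fun t => H (clamp T t) := by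
  obtain ⟨hX, hc, hm⟩ := h
  have hcurve : VagueCurve fun t => H (clamp T t) :=
    ⟨fun t => (hX _ (clamp_mem hT t)).1,
      fun t => (hX _ (clamp_mem hT t)).isFiniteMeasureOnCompacts,
      fun φ hφ => (hc φ hφ.cont hφ.supp).comp_continuous (continuous_clamp T) (clamp_mem hT)⟩
  refine ⟨hcurve, fun t φ hφ => ?_⟩
  rw [hm _ (clamp_mem hT t) φ hφ.cont hφ.supp]
  exact mild_eq_duhamel hk hcurve (fun s hs => by rw [clamp_of_mem hs]) (clamp_mem hT t) hφ

/-- Local well-posedness of the regularized problem: for every `h₀ ∈ 𝒳_ρ` there are `T > 0`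
and a unique mild solution `H ∈ C([0,T];𝒳_ρ)` with datum `h₀`; it satisfies
`sup_{0≤t≤T} ‖H(·,t)‖_{𝒳_ρ} ≤ 2‖h₀‖_{𝒳_ρ}` (nonnegativity `H(·,t) ≥ 0` holds since the
`H(·,t)` are measures). -/
theorem local_wellposedness_regularized
    (γ C ρ β lam : ℝ) (K : ℝ → ℝ → ℝ) (ζ : ℝ → ℝ)
    (hγ : γ ∈ Ico (0:ℝ) 1) (hC : 0 < C) (hK : KernelHyp K γ C) (hζ : CutoffHyp ζ)
    (hρ : ρ ∈ Ioo γ 1) (hβ : β = 1 / (ρ - γ)) (hlam : lam ∈ Ioo (0:ℝ) (1/2))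
    (h0 : Measure ℝ) (hh0 : MemX ρ h0) :
    ∃ T > (0:ℝ), ∃ H : ℝ → Measure ℝ,
      IsMildSolution (Kreg K ζ lam) β ρ T h0 H ∧
      (∀ t ∈ Icc (0:ℝ) T, Xnorm ρ (H t) ≤ 2 * Xnorm ρ h0) ∧
      (∀ H' : ℝ → Measure ℝ, IsMildSolution (Kreg K ζ lam) β ρ T h0 H' →
        ∀ t ∈ Icc (0:ℝ) T, H' t = H t) := by
  have hρ0 : 0 < ρ := hγ.1.trans_lt hρ.1
  have hβ0 : 0 < β := by
    rw [hβ]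
    exact one_div_pos.2 (by linarith [hρ.1])
  have hb : 0 ≤ β * ρ := by positivity
  have hk := regKernel_rateDensity hK hζ hγ hC hlam.1 hβ0.le
  have hfin := hh0.isFiniteMeasureOnCompacts
  set L := C * ((2 / lam) ^ γ + 1) * (1 + 2 / lam) ^ (1 - γ)
  set N := ∫ x, weight γ x ∂h0
  have hN : Integrable (weight γ) h0 ∧ ∫ x, weight γ x ∂h0 ≤ N :=
    ⟨hh0.integrable_weight hρ, le_rfl⟩
  have hN0 : 0 ≤ N := integral_nonneg fun x => (weight_pos γ x).le
  have hNB : N < N + 1 := lt_add_one N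
  obtain ⟨T, hT0, hTB, hTκ, hT1, hT2⟩ := exists_short_time (β * ρ) N L hNB
  obtain ⟨H, hH, hs⟩ := hk.exists_clampedSolution hh0.1 hb hN hT0.le hNB.le hTB.le hTκ
  have hmass : ∀ t ∈ Icc 0 T, ∀ R ε : ℝ, 0 < ε → H t (Icc 0 R) ≤ 2 * h0 (Icc 0 (R + ε)) :=
    fun t ht R ε hε => hk.measure_Icc_le hh0.1 hb hH hs hT1 hT2 hε ht
  refine ⟨T, hT0, H, ⟨fun t ht => ⟨hH.curve.null t, ?_⟩, fun φ hφ hφ' =>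
    (hH.curve.cont φ ⟨hφ, hφ'⟩).continuousOn, fun t ht φ hφ hφ' => ?_⟩, fun t ht =>
    Xnorm_le_two_mul hρ.2 hh0 (hmass t ht), fun H' hH' t ht => ?_⟩
  · obtain ⟨-, M, hM⟩ := hh0
    exact ⟨2 * M, fun R hR => measure_Icc_le_two_mul hρ.2 (hmass t ht) hM hR⟩
  · rw [mild_eq_duhamel hk hH.curve (fun _ _ => rfl) ht ⟨hφ, hφ'⟩, hs t φ ⟨hφ, hφ'⟩,
      clamp_of_mem ht]
  · obtain ⟨hcurve, hs'⟩ := hH'.isClampedSolution hk hT0.le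
    have hB' := hk.boundedCurve_of_isClampedSolution hh0.1 hb hN hT0.le (hN0.trans hNB.le) hTB
      hcurve (fun s => by rw [clamp_of_mem (clamp_mem hT0.le s)]) hs'
    have := hk.clampedSolution_unique hb hN hT0.le hTκ hB' hH hs' hs t
    rwa [clamp_of_mem ht] at this

end Smol
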